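/- arXiv:2207.00652 — 3 statements merged into one kernel-verified Lean document; each statement's English description precedes it below -/
import Mathlib

section
/- (Strichartz inequality for the Schrödinger equation on ℝ^d.) Let d ≥ 1 and let u_0 : ℝ^d → ℂ be a Schwartz function. Define the solution of the linear Schrödinger equation ∂_t u = iΔu with initial data u_0 by u(x,t) = ∫_{ℝ^d} û_0(ξ) e^{2πi x·ξ} e^{−4π² i |ξ|² t} dξ, where û_0 is the Fourier transform of u_0. Then there is a constant C(d) with ‖u‖_{L^{2(d+2)/d}(ℝ^d × ℝ)} ≤ C(d) ‖u_0‖_{L²(ℝ^d)}. -/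
open MeasureTheory

open scoped ENNReal NNReal ComplexConjugate

lemma lintegral_comp_abs_eq_two_mul (f : ℝ → ℝ≥0∞) :
    ∫⁻ r, f |r| = 2 * ∫⁻ r in Set.Ioi 0, f r := by
  have h : ∫⁻ r in Set.Iio (0:ℝ), f |r| = ∫⁻ r in Set.Ioi 0, f r := by
    have e := (Measure.measurePreserving_neg (volume : Measure ℝ)).setLIntegral_comp_preimage_emb
      (MeasurableEquiv.neg ℝ).measurableEmbedding (fun r => f |r|) (Set.Iio 0)
    rw [← e]
    simp only [Set.neg_preimage, Set.neg_Iio, neg_zero, abs_neg]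
    exact setLIntegral_congr_fun measurableSet_Ioi fun r hr => by rw [abs_of_pos hr]
  rw [← lintegral_add_compl _ (measurableSet_Iio : MeasurableSet (Set.Iio (0:ℝ))), Set.compl_Iio, h,
    setLIntegral_congr (Ioi_ae_eq_Ici (μ := volume) (a := (0:ℝ))).symm, two_mul]
  congr 1
  exact setLIntegral_congr_fun measurableSet_Ioi fun r hr => by rw [abs_of_pos hr]

lemma lintegral_abs_rpow_near {α : ℝ} (hα : α < 1) {δ : ℝ} (hδ : 0 < δ) :
    ∫⁻ r, Set.indicator {r : ℝ | |r| ≤ δ} (fun r => ENNReal.ofReal (|r| ^ (-α))) r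
      = ENNReal.ofReal (2 / (1 - α) * δ ^ (1 - α)) := by
  have h : ∀ r : ℝ, Set.indicator {r : ℝ | |r| ≤ δ} (fun r => ENNReal.ofReal (|r| ^ (-α))) r
      = Set.indicator (Set.Iic δ) (fun r => ENNReal.ofReal (r ^ (-α))) |r| := by
    intro r; simp [Set.indicator]
  simp_rw [h]
  rw [lintegral_comp_abs_eq_two_mul, setLIntegral_indicator measurableSet_Iic, Set.inter_comm,
    Set.Ioi_inter_Iic, ← ofReal_integral_eq_lintegral_ofReal]
  · rw [← intervalIntegral.integral_of_le hδ.le, integral_rpow (Or.inl (by linarith)),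
      Real.zero_rpow (by linarith), sub_zero, ← ENNReal.ofReal_ofNat,
          ← ENNReal.ofReal_mul (by norm_num)]
    rw [show -α + 1 = 1 - α by ring]
    congr 1; ring
  · exact (intervalIntegrable_iff_integrableOn_Ioc_of_le hδ.le).1
      (intervalIntegral.intervalIntegrable_rpow' (by linarith))
  · filter_upwards [ae_restrict_mem measurableSet_Ioc] with r hr
    exact Real.rpow_nonneg hr.1.le _

lemma lintegral_abs_rpow_far {δ : ℝ} (hδ : 0 < δ) :
    ∫⁻ r, Set.indicator {r : ℝ | δ < |r|} (fun r => ENNReal.ofReal (|r| ^ (-2 : ℝ))) r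
      = ENNReal.ofReal (2 / δ) := by
  have h : ∀ r : ℝ, Set.indicator {r : ℝ | δ < |r|} (fun r => ENNReal.ofReal (|r| ^ (-2 : ℝ))) r
      = Set.indicator (Set.Ioi δ) (fun r => ENNReal.ofReal (r ^ (-2 : ℝ))) |r| := by
    intro r; simp [Set.indicator]
  simp_rw [h]
  rw [lintegral_comp_abs_eq_two_mul, setLIntegral_indicator measurableSet_Ioi,
    Set.Ioi_inter_Ioi, sup_eq_left.2 hδ.le, ← ofReal_integral_eq_lintegral_ofReal]
  · rw [integral_Ioi_rpow_of_lt (by norm_num) hδ, ← ENNReal.ofReal_ofNat,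
        ← ENNReal.ofReal_mul (by norm_num)]
    congr 1
    norm_num [Real.rpow_neg_one]
    ring
  · exact integrableOn_Ioi_rpow_of_lt (by norm_num) hδ
  · filter_upwards [ae_restrict_mem measurableSet_Ioi] with r hr
    exact Real.rpow_nonneg (hδ.le.trans (le_of_lt hr)) _

lemma lintegral_rpow_neg_mul_le {α q : ℝ} (hα0 : 0 < α) (hα1 : α < 1) (hq : q = 2 / (2 - α)) :
    ∃ C : ℝ≥0, ∀ (s : ℝ) (g : ℝ → ℝ≥0∞) (a N : ℝ), Measurable g → 0 < a → 0 < N →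
      (∀ t, g t ≤ ENNReal.ofReal a) → ∫⁻ t, g t ^ q ≤ ENNReal.ofReal N →
      ∫⁻ t, ENNReal.ofReal (|s - t| ^ (-α)) * g t
        ≤ C * ENNReal.ofReal (a ^ (q - 1) * N ^ (1 - α)) := by
  refine ⟨Real.toNNReal (2 / (1 - α) + 2 ^ (α / 2)), fun s g a N hg ha hN hga hgN => ?_⟩
  have hq0 : 0 < q := by rw [hq]; exact div_pos two_pos (by linarith)
  set δ : ℝ := N / a ^ q with hδdef
  have hδ : 0 < δ := by positivity
  set A : Set ℝ := {t | |s - t| ≤ δ} with hA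
  have hAm : MeasurableSet A := measurableSet_le (by fun_prop) (by fun_prop)
  have hk : Measurable fun t : ℝ => ENNReal.ofReal (|s - t| ^ (-α)) := by fun_prop
  have hnear : ∫⁻ t in A, ENNReal.ofReal (|s - t| ^ (-α)) * g t
      ≤ ENNReal.ofReal (2 / (1 - α) * δ ^ (1 - α)) * ENNReal.ofReal a := by
    calc _ ≤ ∫⁻ t in A, ENNReal.ofReal (|s - t| ^ (-α)) * ENNReal.ofReal a := by
          gcongr; exact hga _
      _ = (∫⁻ t in A, ENNReal.ofReal (|s - t| ^ (-α))) * ENNReal.ofReal a :=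
          lintegral_mul_const _ hk
      _ = _ := by
          rw [← lintegral_abs_rpow_near hα1 hδ, ← lintegral_indicator hAm,
            ← lintegral_sub_left_eq_self _ s]
          simp [hA, Set.indicator]
  have hfar : ∫⁻ t in Aᶜ, ENNReal.ofReal (|s - t| ^ (-α)) * g t
      ≤ ENNReal.ofReal (2 / δ) ^ (α / 2) * ENNReal.ofReal N ^ (1 / q) := by
    have hconj : (2 / α).HolderConjugate q := by
      rw [Real.holderConjugate_iff, hq]
      refine ⟨?_, ?_⟩
      · rw [lt_div_iff₀ hα0]; linarith
      · field_simp; ring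
    refine (ENNReal.lintegral_mul_le_Lp_mul_Lq _ hconj hk.aemeasurable hg.aemeasurable).trans ?_
    rw [one_div_div]
    gcongr
    · rw [← lintegral_abs_rpow_far hδ, ← lintegral_indicator hAm.compl,
        ← lintegral_sub_left_eq_self _ s]
      refine lintegral_mono fun t => ?_
      simp only [Set.indicator, hA, Set.mem_compl_iff, Set.mem_ofPred_eq, not_le, sub_sub_cancel]
      split_ifs
      · rw [ENNReal.ofReal_rpow_of_nonneg (by positivity) (by positivity),
            ← Real.rpow_mul (abs_nonneg _)]
        apply le_of_eq; congr 2; field_simp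
      · rfl
    · exact (setLIntegral_le_lintegral _ _).trans hgN
  rw [← lintegral_add_compl _ hAm]
  refine (add_le_add hnear hfar).trans ?_
  rw [ENNReal.ofReal_rpow_of_pos (by positivity), ENNReal.ofReal_rpow_of_pos hN,
    ← ENNReal.ofReal_mul (by have : 0 < 1 - α := by linarith
                             positivity), ← ENNReal.ofReal_mul (by positivity),
    ← ENNReal.ofReal_add (by have : 0 < 1 - α := by linarith
                             positivity) (by positivity), ENNReal.ofNNReal_toNNReal,
    ← ENNReal.ofReal_mul (by have : 0 < 1 - α := by linarith
                             positivity)]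
  apply le_of_eq; congr 1
  have h2α : 2 - α ≠ 0 := by linarith
  have e1 : δ ^ (1 - α) * a = a ^ (q - 1) * N ^ (1 - α) := by
    rw [hδdef, Real.div_rpow hN.le (by positivity), ← Real.rpow_mul ha.le, div_mul_eq_mul_div,
      div_eq_iff (by positivity), mul_right_comm, ← Real.rpow_add ha]
    rw [show q - 1 + q * (1 - α) = 1 by rw [hq]; field_simp; ring, Real.rpow_one, mul_comm]
  have e2 : (2 / δ) ^ (α / 2) * N ^ (1 / q) = 2 ^ (α / 2) * (a ^ (q - 1) * N ^ (1 - α)) := by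
    rw [hδdef, div_div_eq_mul_div, Real.div_rpow (by positivity) hN.le,
        Real.mul_rpow (by norm_num) (by positivity),
      ← Real.rpow_mul ha.le, show q * (α / 2) = q - 1 by rw [hq]; field_simp; ring,
      div_mul_eq_mul_div, mul_assoc, mul_div_assoc, mul_div_assoc, ← Real.rpow_sub hN]
    congr 3
    rw [hq]; field_simp; ring
  rw [mul_assoc, e1, e2]; ring

/-- The Hardy–Littlewood–Sobolev inequality on the line, on the diagonal. -/
theorem hardy_littlewood_sobolev_self {α q : ℝ} (hα0 : 0 < α) (hα1 : α < 1) (hq : q = 2 / (2 - α)) :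
    ∃ C : ℝ≥0, ∀ φ : ℝ → ℝ≥0∞, Measurable φ →
      ∫⁻ s, ∫⁻ t, ENNReal.ofReal (|s - t| ^ (-α)) * (φ s * φ t)
        ≤ C * (∫⁻ t, φ t ^ q) ^ (2 / q) := by
  obtain ⟨C, hC⟩ := lintegral_rpow_neg_mul_le hα0 hα1 hq
  have hq1 : 1 < q := by rw [hq, lt_div_iff₀ (by linarith)]; linarith
  have hq0 : 0 < q := by linarith
  refine ⟨2 * max C 1, fun φ hφ => ?_⟩
  rcases eq_or_ne (∫⁻ t, φ t ^ q) ⊤ with hT | hT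
  · rw [hT, ENNReal.top_rpow_of_pos (by positivity), ENNReal.mul_top (by simp)]
    exact le_top
  rcases eq_or_ne (∫⁻ t, φ t ^ q) 0 with h0 | h0
  · have hz : φ =ᵐ[volume] 0 := by
      have := (lintegral_eq_zero_iff (hφ.pow_const q)).1 h0
      filter_upwards [this] with t ht
      simpa [ENNReal.rpow_eq_zero_iff, hq0, hq0.le, hq0.not_gt] using ht
    have : ∫⁻ s, ∫⁻ t, ENNReal.ofReal (|s - t| ^ (-α)) * (φ s * φ t) = 0 := by
      rw [← lintegral_zero (α := ℝ) (μ := volume)]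
      refine lintegral_congr_ae ?_
      filter_upwards [hz] with s hs
      simp [hs]
    rw [this]; exact zero_le
  set N : ℝ := (∫⁻ t, φ t ^ q).toReal with hN
  have hN0 : 0 < N := ENNReal.toReal_pos h0 hT
  have hNe : ∫⁻ t, φ t ^ q = ENNReal.ofReal N := (ENNReal.ofReal_toReal hT).symm
  set K : ℝ → ℝ → ℝ≥0∞ := fun s t =>
    ENNReal.ofReal (|s - t| ^ (-α)) * (φ s * Set.indicator {t | φ t ≤ φ s} φ t) with hK
  have hKm : Measurable (Function.uncurry K) := by
    have : Function.uncurry K = fun z : ℝ × ℝ => ENNReal.ofReal (|z.1 - z.2| ^ (-α)) *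
        (φ z.1 * Set.indicator {z : ℝ × ℝ | φ z.2 ≤ φ z.1} (fun z => φ z.2) z) := by
      ext ⟨s, t⟩; simp [hK, Set.indicator]
    rw [this]
    have hS : MeasurableSet {z : ℝ × ℝ | φ z.2 ≤ φ z.1} :=
      measurableSet_le (hφ.comp measurable_snd) (hφ.comp measurable_fst)
    have := (hφ.comp measurable_snd : Measurable fun z : ℝ × ℝ => φ z.2).indicator hS
    fun_prop
  have hle : ∀ s t, ENNReal.ofReal (|s - t| ^ (-α)) * (φ s * φ t) ≤ K s t + K t s := by
    intro s t
    rcases le_total (φ t) (φ s) with h | h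
    · refine le_trans ?_ le_self_add
      simp [hK, Set.indicator, h]
    · refine le_trans ?_ le_add_self
      simp [hK, Set.indicator, h, abs_sub_comm s t, mul_comm (φ s)]
  have hmain : ∫⁻ s, ∫⁻ t, K s t ≤ C * (∫⁻ t, φ t ^ q) ^ (2 / q) := by
    have hfin : ∀ᵐ s, φ s ^ q < ⊤ := ae_lt_top (hφ.pow_const q) hT
    calc ∫⁻ s, ∫⁻ t, K s t ≤ ∫⁻ s, C * ENNReal.ofReal (N ^ (1 - α)) * φ s ^ q := by
          refine lintegral_mono_ae ?_
          filter_upwards [hfin] with s hs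
          have hs' : φ s ≠ ⊤ := by rintro h; simp [h, hq0] at hs
          rcases eq_or_ne (φ s) 0 with hs0 | hs0
          · simp [hK, hs0]
          set a := (φ s).toReal
          have ha : 0 < a := ENNReal.toReal_pos hs0 hs'
          have hae : φ s = ENNReal.ofReal a := (ENNReal.ofReal_toReal hs').symm
          have hS : MeasurableSet {t | φ t ≤ φ s} := measurableSet_le hφ measurable_const
          have := hC s (Set.indicator {t | φ t ≤ φ s} φ) a N (hφ.indicator hS) ha hN0
            (fun t => by
              rw [← hae]; simp only [Set.indicator, Set.mem_ofPred_eq]; split_ifs with h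
              · exact h
              · exact zero_le)
            (by
              rw [← hNe]; refine lintegral_mono fun t => ?_
              gcongr; exact Set.indicator_le_self _ _ t)
          calc ∫⁻ t, K s t = φ s * ∫⁻ t, ENNReal.ofReal (|s - t| ^ (-α)) *
                Set.indicator {t | φ t ≤ φ s} φ t := by
                rw [← lintegral_const_mul' _ _ hs']
                refine lintegral_congr fun t => ?_
                simp only [hK]; ring
            _ ≤ φ s * (C * ENNReal.ofReal (a ^ (q - 1) * N ^ (1 - α))) := by gcongr
            _ = _ := by
                rw [hae, ENNReal.ofReal_rpow_of_pos ha, ENNReal.ofReal_mul (by positivity),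
                  show ENNReal.ofReal (a ^ q) = ENNReal.ofReal a * ENNReal.ofReal (a ^ (q - 1)) by
                    rw [← ENNReal.ofReal_mul ha.le]; congr 1
                    nth_rw 2 [← Real.rpow_one a]
                    rw [← Real.rpow_add ha]; congr 1; ring]
                ring
      _ = _ := by
          rw [lintegral_const_mul _ (hφ.pow_const q), hNe, mul_assoc,
              ← ENNReal.ofReal_mul (by positivity),
            ENNReal.ofReal_rpow_of_pos hN0]
          congr 2
          nth_rw 2 [← Real.rpow_one N]
          rw [← Real.rpow_add hN0]; congr 1
          rw [hq]; field_simp; ring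
  calc _ ≤ ∫⁻ s, ∫⁻ t, (K s t + K t s) := by gcongr; exact hle _ _
    _ = (∫⁻ s, ∫⁻ t, K s t) + ∫⁻ s, ∫⁻ t, K t s := by
        have hKi : Measurable fun s => ∫⁻ t, K s t := hKm.lintegral_prod_right'
        rw [← lintegral_add_left hKi]
        refine lintegral_congr fun s => ?_
        exact lintegral_add_left (hKm.comp measurable_prodMk_left) _
    _ = 2 * ∫⁻ s, ∫⁻ t, K s t := by
        rw [lintegral_lintegral_swap (f := fun s t => K t s)
          (hKm.comp measurable_swap).aemeasurable, two_mul]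
    _ ≤ _ := by
        push_cast
        rw [mul_assoc]
        gcongr
        refine hmain.trans ?_
        gcongr
        exact le_max_left _ _

lemma lintegral_Ioi_indicator_rpow_le {p q K r : ℝ} (hp : 2 < p) (hq : q = p / (p - 1))
    (hK : 0 < K) (hr : 0 ≤ r) :
    ENNReal.ofReal r ^ (2 : ℝ) * ∫⁻ l in Set.Ioi (0 : ℝ),
      Set.indicator {l : ℝ | l * r ^ (q - 1) ≤ K} (fun l => ENNReal.ofReal (l ^ (p - 3))) l
      = ENNReal.ofReal (K ^ (p - 2) / (p - 2)) * ENNReal.ofReal r ^ q := by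
  have hp1 : 0 < p - 1 := by linarith
  have hp2 : 0 < p - 2 := by linarith
  have hq0 : 0 < q := by rw [hq]; positivity
  rcases hr.eq_or_lt with rfl | hr
  · simp [hq0]
  have hS : {l : ℝ | l * r ^ (q - 1) ≤ K} = Set.Iic (K / r ^ (q - 1)) := by
    ext l; simp [le_div_iff₀ (Real.rpow_pos_of_pos hr (q - 1))]
  have hM : 0 ≤ K / r ^ (q - 1) := by positivity
  rw [hS, setLIntegral_indicator measurableSet_Iic, Set.inter_comm,
    Set.Ioi_inter_Iic, ← ofReal_integral_eq_lintegral_ofReal,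
    ← intervalIntegral.integral_of_le hM, integral_rpow (Or.inl (by linarith)),
    Real.zero_rpow (by linarith), sub_zero, ENNReal.ofReal_rpow_of_pos hr,
    ENNReal.ofReal_rpow_of_pos hr, ← ENNReal.ofReal_mul (by positivity),
    ← ENNReal.ofReal_mul (by positivity), show p - 3 + 1 = p - 2 by ring]
  · congr 1
    have e : r ^ (2 : ℝ) = r ^ q * r ^ ((q - 1) * (p - 2)) := by
      rw [← Real.rpow_add hr]
      congr 1
      rw [hq]; field_simp; ring
    rw [Real.div_rpow hK.le (by positivity), ← Real.rpow_mul hr.le, e]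
    have : 0 < r ^ ((q - 1) * (p - 2)) := by positivity
    field_simp
  · exact (intervalIntegrable_iff_integrableOn_Ioc_of_le hM).1
      (intervalIntegral.intervalIntegrable_rpow' (by linarith))
  · filter_upwards [ae_restrict_mem measurableSet_Ioc] with l hl
    exact Real.rpow_nonneg hl.1.le _

/-- Marcinkiewicz interpolation between an `L¹ → L^∞` bound `D` and an `L² → L²` bound `1`. -/
theorem marcinkiewicz_one_two {X : Type*} [MeasurableSpace X] {μ : Measure X} [SFinite μ]
    {p q : ℝ} (hp : 2 < p) (hq : q = p / (p - 1)) :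
    ∃ C : ℝ≥0, ∀ (f S : X → ℂ) (D : ℝ), Measurable f → Measurable S → 0 < D →
      (∀ A : Set X, MeasurableSet A → ∃ S₁ S₂ : X → ℂ, S = S₁ + S₂ ∧ Measurable S₂ ∧
        (∀ x, ‖S₁ x‖ₑ ≤ ENNReal.ofReal D * ∫⁻ x in A, ‖f x‖ₑ ∂μ) ∧
        ∫⁻ x, ‖S₂ x‖ₑ ^ (2 : ℝ) ∂μ ≤ ∫⁻ x in Aᶜ, ‖f x‖ₑ ^ (2 : ℝ) ∂μ) →
      ∫⁻ x, ‖S x‖ₑ ^ p ∂μ ≤ C * ENNReal.ofReal (D ^ (p - 2)) * (∫⁻ x, ‖f x‖ₑ ^ q ∂μ) ^ (p - 1) := by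
  have hp1 : 0 < p - 1 := by linarith
  have hp2 : 0 < p - 2 := by linarith
  have hq0 : 0 < q := by rw [hq]; exact div_pos (by linarith) hp1
  have hq1 : 1 < q := by rw [hq, lt_div_iff₀ hp1]; linarith
  refine ⟨Real.toNNReal (4 * p * 2 ^ (p - 2) / (p - 2)) + 1, fun f S D hf hS hD h => ?_⟩
  have hfq : Measurable fun x => ‖f x‖ₑ ^ q := hf.enorm.pow_const q
  rcases eq_or_ne (∫⁻ x, ‖f x‖ₑ ^ q ∂μ) ⊤ with hT | hT
  · rw [hT, ENNReal.top_rpow_of_pos hp1, ENNReal.mul_top]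
    · exact le_top
    · refine mul_ne_zero (by simp) ?_
      simpa using Real.rpow_pos_of_pos hD _
  rcases eq_or_ne (∫⁻ x, ‖f x‖ₑ ^ q ∂μ) 0 with h0 | h0
  · have hz : ∀ᵐ x ∂μ, ‖f x‖ₑ = 0 := by
      filter_upwards [(lintegral_eq_zero_iff hfq).1 h0] with x hx
      simpa [ENNReal.rpow_eq_zero_iff, hq0, hq0.le, hq0.not_gt] using hx
    obtain ⟨S₁, S₂, hSS, hm, h1, h2⟩ := h Set.univ MeasurableSet.univ
    have hS1 : ∀ x, S₁ x = 0 := by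
      intro x
      have := h1 x
      rw [Measure.restrict_univ, lintegral_congr_ae hz] at this
      simpa using this
    have hS2 : ∀ᵐ x ∂μ, S₂ x = 0 := by
      simp only [Set.compl_univ, Measure.restrict_empty, lintegral_zero_measure,
          nonpos_iff_eq_zero] at h2
      filter_upwards [(lintegral_eq_zero_iff (hm.enorm.pow_const _)).1 h2] with x hx
      simpa using hx
    have : ∫⁻ x, ‖S x‖ₑ ^ p ∂μ = 0 := by
      rw [lintegral_eq_zero_iff (hS.enorm.pow_const p)]
      filter_upwards [hS2] with x hx
      simp [hSS, hS1, hx, show 0 < p by linarith]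
    rw [this]; exact zero_le
  set N : ℝ := (∫⁻ x, ‖f x‖ₑ ^ q ∂μ).toReal with hN
  have hN0 : 0 < N := ENNReal.toReal_pos h0 hT
  have hNe : ∫⁻ x, ‖f x‖ₑ ^ q ∂μ = ENNReal.ofReal N := (ENNReal.ofReal_toReal hT).symm
  set K : ℝ := 2 * D * N with hK
  have hK0 : 0 < K := by positivity
  have hlevel : ∀ l : ℝ, 0 < l → μ {x | l < ‖S x‖} ≤ ENNReal.ofReal (4 / l ^ 2) *
      ∫⁻ x, Set.indicator {x | l * ‖f x‖ ^ (q - 1) ≤ K} (fun x => ‖f x‖ₑ ^ (2 : ℝ)) x ∂μ := by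
    intro l hl
    have hAc : MeasurableSet {x | l * ‖f x‖ ^ (q - 1) ≤ K} :=
      measurableSet_le (by fun_prop) measurable_const
    obtain ⟨S₁, S₂, hSS, hm, h1, h2⟩ := h {x | l * ‖f x‖ ^ (q - 1) ≤ K}ᶜ hAc.compl
    rw [compl_compl] at h2
    have hA1 : ∫⁻ x in {x | l * ‖f x‖ ^ (q - 1) ≤ K}ᶜ, ‖f x‖ₑ ∂μ ≤ ENNReal.ofReal (l / (2 * D)) :=
        by
      calc _ ≤ ∫⁻ x in {x | l * ‖f x‖ ^ (q - 1) ≤ K}ᶜ, ENNReal.ofReal (l / K) * ‖f x‖ₑ ^ q ∂μ := by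
            refine setLIntegral_mono' hAc.compl fun x hx => ?_
            simp only [Set.mem_compl_iff, Set.mem_ofPred_eq, not_le] at hx
            have hr : 0 < ‖f x‖ := by
              rcases (norm_nonneg (f x)).eq_or_lt with h | h
              · rw [← h, Real.zero_rpow (by linarith), mul_zero] at hx; linarith
              · exact h
            rw [← ofReal_norm, ENNReal.ofReal_rpow_of_pos hr, ← ENNReal.ofReal_mul (by positivity)]
            apply ENNReal.ofReal_le_ofReal
            rw [show q = 1 + (q - 1) by ring, Real.rpow_add hr, Real.rpow_one, div_mul_eq_mul_div,
              le_div_iff₀ hK0]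
            nlinarith
        _ ≤ ENNReal.ofReal (l / K) * ENNReal.ofReal N := by
            rw [lintegral_const_mul _ hfq, ← hNe]
            gcongr
            exact Measure.restrict_le_self
        _ = _ := by
            rw [← ENNReal.ofReal_mul (by positivity)]
            congr 1; rw [hK]; field_simp
    have hS1 : ∀ x, ‖S₁ x‖ ≤ l / 2 := by
      intro x
      have := (h1 x).trans (mul_le_mul_right hA1 _)
      rw [← ENNReal.ofReal_mul hD.le, ← ofReal_norm] at this
      have := (ENNReal.ofReal_le_ofReal_iff (by positivity)).1 this
      refine this.trans (le_of_eq ?_)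
      field_simp
    calc μ {x | l < ‖S x‖} ≤ μ {x | ENNReal.ofReal ((l / 2) ^ 2) ≤ ‖S₂ x‖ₑ ^ (2 : ℝ)} := by
          refine measure_mono fun x hx => ?_
          simp only [Set.mem_ofPred_eq] at hx ⊢
          have : l / 2 ≤ ‖S₂ x‖ := by
            have := norm_add_le (S₁ x) (S₂ x)
            have h3 := hS1 x
            rw [hSS, Pi.add_apply] at hx
            linarith
          rw [← ofReal_norm, ENNReal.ofReal_rpow_of_nonneg (norm_nonneg _) (by norm_num)]
          apply ENNReal.ofReal_le_ofReal
          rw [Real.rpow_two]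
          gcongr
      _ ≤ (∫⁻ x, ‖S₂ x‖ₑ ^ (2 : ℝ) ∂μ) / ENNReal.ofReal ((l / 2) ^ 2) :=
          meas_ge_le_lintegral_div (hm.enorm.pow_const _).aemeasurable
            (by simp; positivity) ENNReal.ofReal_ne_top
      _ ≤ (∫⁻ x in {x | l * ‖f x‖ ^ (q - 1) ≤ K}, ‖f x‖ₑ ^ (2 : ℝ) ∂μ) / ENNReal.ofReal
          ((l / 2) ^ 2) := by
          gcongr
      _ = _ := by
          rw [lintegral_indicator hAc, div_eq_mul_inv, mul_comm,
              ← ENNReal.ofReal_inv_of_pos (by positivity)]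
          congr 2; field_simp; norm_num
  have hSm : MeasurableSet {z : ℝ × X | z.1 * ‖f z.2‖ ^ (q - 1) ≤ K} :=
    measurableSet_le (by fun_prop) measurable_const
  calc ∫⁻ x, ‖S x‖ₑ ^ p ∂μ = ∫⁻ x, ENNReal.ofReal (‖S x‖ ^ p) ∂μ := by
        refine lintegral_congr fun x => ?_
        rw [← ofReal_norm, ENNReal.ofReal_rpow_of_nonneg (norm_nonneg _) (by linarith)]
    _ = ENNReal.ofReal p * ∫⁻ l in Set.Ioi 0, μ {x | l < ‖S x‖} * ENNReal.ofReal (l ^ (p - 1)) :=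
        lintegral_rpow_eq_lintegral_meas_lt_mul μ (ae_of_all _ fun x => norm_nonneg _)
          hS.norm.aemeasurable (by linarith)
    _ ≤ ENNReal.ofReal p * ∫⁻ l in Set.Ioi (0 : ℝ), ∫⁻ x, ENNReal.ofReal 4 *
          Set.indicator {z : ℝ × X | z.1 * ‖f z.2‖ ^ (q - 1) ≤ K}
            (fun z => ENNReal.ofReal (z.1 ^ (p - 3)) * ‖f z.2‖ₑ ^ (2 : ℝ)) (l, x) ∂μ := by
        gcongr ENNReal.ofReal p * ?_
        refine setLIntegral_mono' measurableSet_Ioi fun l hl => ?_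
        rw [Set.mem_Ioi] at hl
        calc _ ≤ (ENNReal.ofReal (4 / l ^ 2) *
              ∫⁻ x, Set.indicator {x | l * ‖f x‖ ^ (q - 1) ≤ K} (fun x => ‖f x‖ₑ ^ (2 : ℝ)) x ∂μ) *
                ENNReal.ofReal (l ^ (p - 1)) := by
              gcongr; exact hlevel l hl
          _ = (ENNReal.ofReal 4 * ENNReal.ofReal (l ^ (p - 3))) *
              ∫⁻ x, Set.indicator {x | l * ‖f x‖ ^ (q - 1) ≤ K} (fun x => ‖f x‖ₑ ^ (2 : ℝ)) x ∂μ :=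
                  by
              rw [mul_right_comm, ← ENNReal.ofReal_mul (by positivity),
                ← ENNReal.ofReal_mul (by norm_num)]
              congr 2
              rw [show p - 3 = p - 1 - 2 by ring, Real.rpow_sub hl (p - 1) 2, Real.rpow_two]
              ring
          _ = _ := by
              rw [← lintegral_const_mul' _ _ (by finiteness)]
              refine lintegral_congr fun x => ?_
              simp only [Set.indicator, Set.mem_ofPred_eq]
              split_ifs
              · ring
              · simp
    _ = ENNReal.ofReal p * ∫⁻ x, ENNReal.ofReal 4 * (‖f x‖ₑ ^ (2 : ℝ) * ∫⁻ l in Set.Ioi (0 : ℝ),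
          Set.indicator {l : ℝ | l * ‖f x‖ ^ (q - 1) ≤ K}
              (fun l => ENNReal.ofReal (l ^ (p - 3))) l) ∂μ := by
        congr 1
        rw [lintegral_lintegral_swap]
        · refine lintegral_congr fun x => ?_
          rw [lintegral_const_mul' _ _ ENNReal.ofReal_ne_top,
            ← lintegral_const_mul' (‖f x‖ₑ ^ (2 : ℝ)) _ (by finiteness)]
          congr 1
          refine lintegral_congr fun l => ?_
          simp only [Set.indicator, Set.mem_ofPred_eq]
          split_ifs
          · ring
          · simp
        · refine Measurable.aemeasurable (Measurable.const_mul (Measurable.indicator ?_ hSm) _)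
          fun_prop
    _ = ENNReal.ofReal p * ∫⁻ x, ENNReal.ofReal 4 *
        (ENNReal.ofReal (K ^ (p - 2) / (p - 2)) * ‖f x‖ₑ ^ q) ∂μ := by
        congr 1
        refine lintegral_congr fun x => ?_
        rw [← ofReal_norm, lintegral_Ioi_indicator_rpow_le hp hq hK0 (norm_nonneg _)]
    _ = ENNReal.ofReal (4 * p * 2 ^ (p - 2) / (p - 2)) * ENNReal.ofReal (D ^ (p - 2)) *
          (∫⁻ x, ‖f x‖ₑ ^ q ∂μ) ^ (p - 1) := by
        rw [lintegral_const_mul' _ _ (by finiteness), lintegral_const_mul' _ _ (by finiteness), hNe,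
          ENNReal.ofReal_rpow_of_pos hN0]
        rw [← ENNReal.ofReal_mul (by positivity), ← ENNReal.ofReal_mul (by positivity),
          ← ENNReal.ofReal_mul (by positivity), ← ENNReal.ofReal_mul (by positivity),
          ← ENNReal.ofReal_mul (by positivity)]
        congr 1
        rw [hK, Real.mul_rpow (by positivity) hN0.le, Real.mul_rpow (by positivity) hD.le,
          show p - 1 = p - 2 + 1 by ring, Real.rpow_add hN0, Real.rpow_one]
        ring
    _ ≤ _ := by
        gcongr
        rw [ENNReal.coe_add]
        exact le_self_add

/-- The plane wave `e^{i(2π x·ξ - 4π² |ξ|² t)}` solving the free Schrödinger equation. -/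
noncomputable def planeWave {d : ℕ} (ξ x : Fin d → ℝ) (t : ℝ) : ℂ :=
  Complex.exp (((2 * Real.pi * ∑ j, x j * ξ j - 4 * Real.pi ^ 2 * (∑ j, ξ j ^ 2) * t : ℝ) : ℂ) *
    Complex.I)

/-- The Gaussian frequency cutoff `e^{-ε |ξ|²}`. -/
noncomputable def gaussianCutoff {d : ℕ} (ε : ℝ) (ξ : Fin d → ℝ) : ℝ :=
  Real.exp (-ε * ∑ j, ξ j ^ 2)

/-- The regularized Schrödinger kernel. -/
noncomputable def schrodingerKernel {d : ℕ} (ε : ℝ) (x : Fin d → ℝ) (t : ℝ) : ℂ :=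
  ∫ ξ : Fin d → ℝ, (gaussianCutoff ε ξ : ℂ) * planeWave ξ x t

section
variable {d : ℕ}

lemma measurable_planeWave {X : Type*} [MeasurableSpace X] {f g : X → Fin d → ℝ} {h : X → ℝ}
    (hf : Measurable f) (hg : Measurable g) (hh : Measurable h) :
    Measurable fun z => planeWave (f z) (g z) (h z) := by
  have hf' : ∀ j, Measurable fun z => f z j := fun j => (measurable_pi_apply j).comp hf
  have hg' : ∀ j, Measurable fun z => g z j := fun j => (measurable_pi_apply j).comp hg
  unfold planeWave
  fun_prop

@[simp]
lemma norm_planeWave (ξ x : Fin d → ℝ) (t : ℝ) : ‖planeWave ξ x t‖ = 1 :=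
  Complex.norm_exp_ofReal_mul_I _

lemma planeWave_mul_conj (ξ x y : Fin d → ℝ) (t s : ℝ) :
    planeWave ξ x t * conj (planeWave ξ y s) = planeWave ξ (x - y) (t - s) := by
  unfold planeWave
  rw [← Complex.exp_conj, ← Complex.exp_add]
  congr 1
  simp only [map_mul, Complex.conj_ofReal, Complex.conj_I, Pi.sub_apply, sub_mul,
    Finset.sum_sub_distrib]
  push_cast
  ring

@[fun_prop]
lemma continuous_gaussianCutoff (ε : ℝ) :
    Continuous fun ξ : Fin d → ℝ => gaussianCutoff ε ξ := by
  unfold gaussianCutoff; fun_prop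

lemma gaussianCutoff_pos (ε : ℝ) (ξ : Fin d → ℝ) : 0 < gaussianCutoff ε ξ := Real.exp_pos _

lemma gaussianCutoff_le_one {ε : ℝ} (hε : 0 < ε) (ξ : Fin d → ℝ) : gaussianCutoff ε ξ ≤ 1 := by
  refine Real.exp_le_one_iff.2 ?_
  have : 0 ≤ ∑ j, ξ j ^ 2 := Finset.sum_nonneg fun j _ => sq_nonneg _
  nlinarith

lemma gaussianCutoff_mul_planeWave (ε : ℝ) (ξ x : Fin d → ℝ) (t : ℝ) :
    (gaussianCutoff ε ξ : ℂ) * planeWave ξ x t =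
      Complex.exp (-∑ j, ((ε : ℂ) + 4 * Real.pi ^ 2 * t * Complex.I) * (ξ j : ℂ) ^ 2 +
        ∑ j, (2 * Real.pi * Complex.I * x j) * ξ j) := by
  unfold gaussianCutoff planeWave
  rw [Complex.ofReal_exp, ← Complex.exp_add]
  congr 1
  push_cast
  rw [← Finset.mul_sum, show ∑ j, 2 * (Real.pi : ℂ) * Complex.I * x j * ξ j =
    2 * (Real.pi : ℂ) * Complex.I * ∑ j, (x j : ℂ) * ξ j by
      rw [Finset.mul_sum]; exact Finset.sum_congr rfl fun j _ => by ring]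
  ring

lemma integrable_gaussianCutoff {ε : ℝ} (hε : 0 < ε) :
    Integrable fun ξ : Fin d → ℝ => gaussianCutoff ε ξ := by
  have h := GaussianFourier.integrable_cexp_neg_sum_mul_add (ι := Fin d) (b := fun _ => (ε : ℂ))
    (fun _ => by simpa using hε) 0
  refine h.norm.congr (ae_of_all _ fun ξ => ?_)
  simp only [gaussianCutoff, Complex.norm_exp]
  congr 1
  simp [← Finset.mul_sum, ← Complex.ofReal_pow, ← Complex.ofReal_mul, ← Complex.ofReal_sum]

lemma schrodingerKernel_eq {ε : ℝ} (hε : 0 < ε) (x : Fin d → ℝ) (t : ℝ) :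
    schrodingerKernel ε x t = ∏ j, (Real.pi / ((ε : ℂ) + 4 * Real.pi ^ 2 * t * Complex.I)) ^
        (1 / 2 : ℂ) *
      Complex.exp ((2 * Real.pi * Complex.I * x j) ^ 2 /
        (4 * ((ε : ℂ) + 4 * Real.pi ^ 2 * t * Complex.I))) := by
  unfold schrodingerKernel
  simp_rw [gaussianCutoff_mul_planeWave]
  refine GaussianFourier.integral_cexp_neg_sum_mul_add (fun _ => ?_) _
  simpa [← Complex.ofReal_pow] using hε

lemma norm_schrodingerKernel_le {ε : ℝ} (hε : 0 < ε) (x : Fin d → ℝ) {t : ℝ} (ht : t ≠ 0) :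
    ‖schrodingerKernel ε x t‖ ≤ (4 * Real.pi * |t|) ^ (-((d : ℝ) / 2)) := by
  set b : ℂ := (ε : ℂ) + 4 * Real.pi ^ 2 * t * Complex.I with hb
  have hπ := Real.pi_pos
  have ht' : 0 < |t| := abs_pos.2 ht
  have hbre : b.re = ε := by simp [hb, ← Complex.ofReal_pow]
  have hbim : b.im = 4 * Real.pi ^ 2 * t := by simp [hb, ← Complex.ofReal_pow]
  have hb0 : b ≠ 0 := fun h => by rw [h] at hbre; simp at hbre; linarith
  have hbn : 4 * Real.pi ^ 2 * |t| ≤ ‖b‖ := by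
    have := Complex.abs_im_le_norm b
    rwa [hbim, abs_mul, abs_of_pos (by positivity)] at this
  have hfac : ∀ j, ‖(Real.pi / b) ^ (1 / 2 : ℂ) *
      Complex.exp ((2 * Real.pi * Complex.I * x j) ^ 2 / (4 * b))‖
      ≤ (4 * Real.pi * |t|) ^ (-(1 / 2 : ℝ)) := by
    intro j
    have h1 : ‖Complex.exp ((2 * Real.pi * Complex.I * x j) ^ 2 / (4 * b))‖ ≤ 1 := by
      rw [Complex.norm_exp, Real.exp_le_one_iff]
      have : (2 * Real.pi * Complex.I * x j) ^ 2 / (4 * b) = ((-(Real.pi ^ 2 * x j ^ 2) : ℝ) : ℂ) *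
          b⁻¹ := by
        field_simp
        push_cast
        linear_combination (4 * (Real.pi:ℂ) ^ 2 * x j ^ 2) * Complex.I_sq
      rw [this, Complex.re_ofReal_mul, Complex.inv_re, hbre]
      have : 0 ≤ Real.pi ^ 2 * x j ^ 2 * (ε / Complex.normSq b) :=
        mul_nonneg (by positivity) (div_nonneg hε.le (Complex.normSq_nonneg b))
      linarith
    have h2 : ‖(Real.pi / b : ℂ) ^ (1 / 2 : ℂ)‖ = (‖b‖ / Real.pi) ^ (-(1 / 2 : ℝ)) := by
      have hne : (Real.pi / b : ℂ) ≠ 0 := div_ne_zero (by exact_mod_cast hπ.ne') hb0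
      rw [show (1 / 2 : ℂ) = ((1 / 2 : ℝ) : ℂ) by push_cast; rfl,
        Complex.norm_cpow_real, norm_div, Complex.norm_real, Real.norm_of_nonneg hπ.le,
        Real.rpow_neg (by positivity), ← Real.inv_rpow (by positivity), inv_div]
    rw [norm_mul, h2]
    refine (mul_le_of_le_one_right (by positivity) h1).trans ?_
    refine Real.rpow_le_rpow_of_nonpos (by positivity) ?_ (by norm_num)
    rw [le_div_iff₀ hπ]
    linarith [hbn]
  rw [schrodingerKernel_eq hε, norm_prod]
  refine (Finset.prod_le_prod (fun _ _ => norm_nonneg _) fun j _ => hfac j).trans ?_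
  rw [Finset.prod_const, Finset.card_univ, Fintype.card_fin, ← Real.rpow_natCast,
    ← Real.rpow_mul (by positivity)]
  apply le_of_eq; congr 1; ring

lemma norm_schrodingerKernel_zero {ε : ℝ} (hε : 0 < ε) (x : Fin d → ℝ) :
    ‖schrodingerKernel ε x 0‖ = (Real.pi / ε) ^ ((d : ℝ) / 2) *
        gaussianCutoff (Real.pi ^ 2 / ε) x := by
  have hπ := Real.pi_pos
  rw [schrodingerKernel_eq hε, Finset.prod_mul_distrib, Finset.prod_const, ← Complex.exp_sum,
    norm_mul, norm_pow, Complex.norm_exp, Finset.card_univ, Fintype.card_fin, gaussianCutoff]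
  congr 1
  · rw [show (1 / 2 : ℂ) = ((1 / 2 : ℝ) : ℂ) by push_cast; rfl,
        Complex.norm_cpow_real]
    simp only [Complex.ofReal_zero, mul_zero, zero_mul, add_zero, norm_div, Complex.norm_real,
      Real.norm_of_nonneg hπ.le, Real.norm_of_nonneg hε.le]
    rw [← Real.rpow_natCast, ← Real.rpow_mul (by positivity)]
    congr 1; ring
  · congr 1
    rw [Complex.re_sum, Finset.mul_sum]
    refine Finset.sum_congr rfl fun j _ => ?_
    have : (2 * Real.pi * Complex.I * x j) ^ 2 / (4 *
        ((ε : ℂ) + 4 * Real.pi ^ 2 * (0 : ℝ) * Complex.I))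
        = ((-(Real.pi ^ 2 / ε) * x j ^ 2 : ℝ) : ℂ) := by
      have : (ε : ℂ) ≠ 0 := by exact_mod_cast hε.ne'
      push_cast
      simp only [mul_zero, zero_mul, add_zero]
      field_simp
      linear_combination (4 * (x j : ℂ) ^ 2) * Complex.I_sq
    rw [this, Complex.ofReal_re]

lemma integral_gaussianCutoff {ε : ℝ} (hε : 0 < ε) :
    ∫ x : Fin d → ℝ, gaussianCutoff ε x = (Real.pi / ε) ^ ((d : ℝ) / 2) := by
  have hπ := Real.pi_pos
  have h1 : schrodingerKernel ε (0 : Fin d → ℝ) 0 =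
      ((∫ x : Fin d → ℝ, gaussianCutoff ε x : ℝ) : ℂ) := by
    rw [schrodingerKernel, ← integral_complex_ofReal]
    refine integral_congr_ae (ae_of_all _ fun ξ => ?_)
    simp [planeWave]
  have h2 := norm_schrodingerKernel_zero hε (0 : Fin d → ℝ)
  rw [h1, Complex.norm_real, Real.norm_of_nonneg (integral_nonneg fun x =>
      (gaussianCutoff_pos ε x).le)] at h2
  rw [h2]; simp [gaussianCutoff]

lemma lintegral_enorm_schrodingerKernel_zero {ε : ℝ} (hε : 0 < ε) :
    ∫⁻ x : Fin d → ℝ, ‖schrodingerKernel ε x 0‖ₑ = 1 := by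
  have hπ := Real.pi_pos
  simp_rw [← ofReal_norm, norm_schrodingerKernel_zero hε]
  rw [← ofReal_integral_eq_lintegral_ofReal, integral_const_mul,
      integral_gaussianCutoff (by positivity),
    ← Real.mul_rpow (by positivity) (by positivity)]
  · rw [show Real.pi / ε * (Real.pi / (Real.pi ^ 2 / ε)) = 1 by field_simp]
    simp
  · exact (integrable_gaussianCutoff (by positivity)).const_mul _
  · exact ae_of_all _ fun x => mul_nonneg (by positivity) (gaussianCutoff_pos _ x).le

lemma lintegral_le_of_gaussianCutoff {G : (Fin d → ℝ) → ℝ≥0∞} (hG : Measurable G) {A : ℝ≥0∞}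
    (h : ∀ ε > 0, ∫⁻ ξ, ENNReal.ofReal (gaussianCutoff ε ξ) * G ξ ≤ A) : ∫⁻ ξ, G ξ ≤ A := by
  set e : ℕ → ℝ := fun n => 1 / ((n : ℝ) + 1)
  have hlim : ∀ ξ, Filter.Tendsto (fun n => ENNReal.ofReal (gaussianCutoff (e n) ξ) * G ξ)
      Filter.atTop (nhds (G ξ)) := by
    intro ξ
    have h1 : Filter.Tendsto (fun n => gaussianCutoff (e n) ξ) Filter.atTop (nhds 1) := by
      have hc : Continuous fun a : ℝ => gaussianCutoff a ξ := by unfold gaussianCutoff; fun_prop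
      have := (hc.tendsto 0).comp (tendsto_one_div_add_atTop_nhds_zero_nat (𝕜 := ℝ))
      simpa [gaussianCutoff, e, Function.comp_def] using this
    have := ENNReal.Tendsto.mul_const (b := G ξ) (ENNReal.tendsto_ofReal h1) (Or.inl (by simp))
    simpa using this
  calc ∫⁻ ξ, G ξ = ∫⁻ ξ, Filter.liminf (fun n => ENNReal.ofReal (gaussianCutoff (e n) ξ) *
      G ξ) Filter.atTop :=
        lintegral_congr fun ξ => (hlim ξ).liminf_eq.symm
    _ ≤ Filter.liminf (fun n => ∫⁻ ξ, ENNReal.ofReal (gaussianCutoff (e n) ξ) * G ξ) Filter.atTop :=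
        lintegral_liminf_le fun n => by fun_prop
    _ ≤ Filter.liminf (fun _ : ℕ => A) Filter.atTop :=
        Filter.liminf_le_liminf (Filter.Eventually.of_forall fun n => h _ (by positivity))
    _ = A := Filter.liminf_const A

end

/-- Expanding the square in a weighted `L²` norm of a superposition. -/
lemma lintegral_weight_mul_enorm_integral_sq_le {Ω Y : Type*} [MeasurableSpace Ω]
    [MeasurableSpace Y] {μ : Measure Ω} {ν : Measure Y} [SFinite μ] [SFinite ν] {h : Ω → Y → ℂ}
    (hm : Measurable (Function.uncurry h)) {n : Ω → ℝ} (hn : Integrable n μ)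
    (hle : ∀ ω y, ‖h ω y‖ ≤ n ω) {w : Y → ℝ} (hw : Integrable w ν) (hwm : Measurable w)
    (hw0 : ∀ y, 0 ≤ w y) :
    ∫⁻ y, ENNReal.ofReal (w y) * ‖∫ ω, h ω y ∂μ‖ₑ ^ (2 : ℝ) ∂ν ≤
      ∫⁻ ω, ∫⁻ ω', ‖∫ y, (w y : ℂ) * (h ω y * conj (h ω' y)) ∂ν‖ₑ ∂μ ∂μ := by
  have hint : Integrable (Function.uncurry fun (y : Y) (z : Ω × Ω) =>
      (w y : ℂ) * (h z.1 y * conj (h z.2 y))) (ν.prod (μ.prod μ)) := by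
    refine Integrable.mono' (hw.mul_prod (hn.mul_prod hn)) ?_ (ae_of_all _ fun ⟨y, ω, ω'⟩ => ?_)
    · have h1 : Measurable fun z : Y × Ω × Ω => h z.2.1 z.1 :=
        hm.comp (measurable_snd.fst.prodMk measurable_fst)
      have h2 : Measurable fun z : Y × Ω × Ω => h z.2.2 z.1 :=
        hm.comp (measurable_snd.snd.prodMk measurable_fst)
      have h3 := Complex.measurable_ofReal.comp (hwm.comp
          (measurable_fst : Measurable fun z : Y × Ω × Ω => z.1))
      exact (h3.mul (h1.mul (Complex.continuous_conj.measurable.comp h2))).aestronglyMeasurable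
    · simp only [Function.uncurry_apply_pair, norm_mul, Complex.norm_real, RCLike.norm_conj,
        Real.norm_of_nonneg (hw0 y)]
      gcongr
      · exact hw0 y
      · exact (norm_nonneg _).trans (hle ω y)
      · exact hle ω y
      · exact hle ω' y
  have hsq : ∀ y, ∫ z : Ω × Ω, (w y : ℂ) * (h z.1 y * conj (h z.2 y)) ∂(μ.prod μ)
      = ((w y * ‖∫ ω, h ω y ∂μ‖ ^ 2 : ℝ) : ℂ) := by
    intro y
    rw [integral_const_mul, integral_prod_mul (fun ω => h ω y) (fun ω => conj (h ω y)),
        integral_conj,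
      Complex.mul_conj']
    push_cast; rfl
  have hre : Integrable (fun y => w y * ‖∫ ω, h ω y ∂μ‖ ^ 2) ν := by
    have := hint.integral_prod_left
    simp only [Function.uncurry_apply_pair, hsq] at this
    exact this.re
  calc _ = ∫⁻ y, ENNReal.ofReal (w y * ‖∫ ω, h ω y ∂μ‖ ^ 2) ∂ν := by
        refine lintegral_congr fun y => ?_
        rw [ENNReal.ofReal_mul (hw0 y), ← ofReal_norm,
          ENNReal.ofReal_rpow_of_nonneg (norm_nonneg _) (by norm_num), Real.rpow_two]
    _ = ‖∫ y, ((w y * ‖∫ ω, h ω y ∂μ‖ ^ 2 : ℝ) : ℂ) ∂ν‖ₑ := by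
        have hp : ∀ y, 0 ≤ w y * ‖∫ ω, h ω y ∂μ‖ ^ 2 := fun y => mul_nonneg (hw0 y) (sq_nonneg _)
        rw [← ofReal_integral_eq_lintegral_ofReal hre (ae_of_all _ hp), integral_complex_ofReal,
          ← ofReal_norm, Complex.norm_real, Real.norm_of_nonneg (integral_nonneg hp)]
    _ = ‖∫ z : Ω × Ω, ∫ y, (w y : ℂ) * (h z.1 y * conj (h z.2 y)) ∂ν ∂(μ.prod μ)‖ₑ := by
        rw [← integral_integral_swap hint]
        simp_rw [hsq]
    _ ≤ ∫⁻ z : Ω × Ω, ‖∫ y, (w y : ℂ) * (h z.1 y * conj (h z.2 y)) ∂ν‖ₑ ∂(μ.prod μ) :=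
        enorm_integral_le_lintegral_enorm _
    _ ≤ _ := lintegral_prod_le _

/-- The space-time Fourier transform of `f` placed at time `t`, restricted to the paraboloid. -/
noncomputable def waveTransform {d : ℕ} (t : ℝ) (f : (Fin d → ℝ) → ℂ) (ξ : Fin d → ℝ) : ℂ :=
  ∫ x, f x * planeWave ξ x t

/-- The (conjugate-linear) regularized Schrödinger evolution from time `s` to time `t`. -/
noncomputable def regularizedEvolution {d : ℕ} (ε t s : ℝ) (g : (Fin d → ℝ) → ℂ)
    (x : Fin d → ℝ) : ℂ :=
  ∫ ξ, (gaussianCutoff ε ξ : ℂ) * conj (waveTransform s g ξ) * planeWave ξ x t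

section
variable {d : ℕ} {f g : (Fin d → ℝ) → ℂ}

lemma integrable_mul_planeWave (hf : Integrable f) (ξ : Fin d → ℝ) (t : ℝ) :
    Integrable fun x => f x * planeWave ξ x t :=
  hf.mul_bdd (c := 1) (measurable_planeWave measurable_const measurable_id
    measurable_const).aestronglyMeasurable (ae_of_all _ fun x => by simp)

lemma integrable_mul_planeWave_frequency (hf : Integrable f) (x : Fin d → ℝ) (t : ℝ) :
    Integrable fun ξ => f ξ * planeWave ξ x t :=
  hf.mul_bdd (c := 1) (measurable_planeWave measurable_id measurable_const
    measurable_const).aestronglyMeasurable (ae_of_all _ fun x => by simp)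

lemma norm_waveTransform_le (t : ℝ) (ξ : Fin d → ℝ) : ‖waveTransform t f ξ‖ ≤ ∫ x, ‖f x‖ :=
  (norm_integral_le_integral_norm _).trans (by simp)

lemma measurable_waveTransform_uncurry {F : ℝ → (Fin d → ℝ) → ℂ}
    (hF : Measurable (Function.uncurry F)) :
    Measurable fun z : ℝ × (Fin d → ℝ) => waveTransform z.1 (F z.1) z.2 := by
  refine (StronglyMeasurable.integral_prod_right (f := fun (z : ℝ × (Fin d → ℝ)) x =>
    F z.1 x * planeWave z.2 x z.1) ?_).measurable
  refine Measurable.stronglyMeasurable (Measurable.mul ?_ ?_)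
  · exact hF.comp (measurable_fst.fst.prodMk measurable_snd)
  · exact measurable_planeWave measurable_fst.snd measurable_snd measurable_fst.fst

lemma measurable_waveTransform (hf : Measurable f) (t : ℝ) : Measurable (waveTransform t f) := by
  have h := measurable_waveTransform_uncurry (F := fun _ => f) (hf.comp measurable_snd)
  exact Measurable.of_uncurry_left (f := fun s => waveTransform s f) (x := t) h

/-- Schur's test for a kernel with unit marginal bounds. -/
lemma lintegral_lintegral_mul_le {X : Type*} [MeasurableSpace X] {μ : Measure X} [SFinite μ]
    {u : X → ℝ≥0∞} (hu : Measurable u) {k : X → X → ℝ≥0∞} (hk : Measurable (Function.uncurry k))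
    (h1 : ∀ x, ∫⁻ y, k x y ∂μ ≤ 1) (h2 : ∀ y, ∫⁻ x, k x y ∂μ ≤ 1) :
    ∫⁻ x, ∫⁻ y, u x * u y * k x y ∂μ ∂μ ≤ ∫⁻ x, u x ^ (2 : ℝ) ∂μ := by
  have hY : ∀ a b : ℝ≥0∞, a * b ≤ 2⁻¹ * (a ^ (2 : ℝ) + b ^ (2 : ℝ)) := by
    intro a b
    have h := ENNReal.young_inequality a b Real.HolderConjugate.two_two
    refine h.trans (le_of_eq ?_)
    rw [ENNReal.ofReal_ofNat, div_eq_mul_inv, div_eq_mul_inv]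
    ring
  have hA : ∫⁻ x, ∫⁻ y, u x ^ (2 : ℝ) * k x y ∂μ ∂μ ≤ ∫⁻ x, u x ^ (2 : ℝ) ∂μ := by
    refine lintegral_mono fun x => ?_
    have hx : Measurable (k x) := hk.of_uncurry_left
    rw [lintegral_const_mul _ hx]
    exact mul_le_of_le_one_right zero_le (h1 x)
  have hB : ∫⁻ x, ∫⁻ y, u y ^ (2 : ℝ) * k x y ∂μ ∂μ ≤ ∫⁻ x, u x ^ (2 : ℝ) ∂μ := by
    rw [lintegral_lintegral_swap]
    · refine lintegral_mono fun y => ?_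
      have hy : Measurable fun x => k x y := hk.of_uncurry_right
      rw [lintegral_const_mul _ hy]
      exact mul_le_of_le_one_right zero_le (h2 y)
    · exact (((hu.pow_const _).comp measurable_snd).mul hk).aemeasurable
  have hAm : Measurable fun x => ∫⁻ y, u x ^ (2 : ℝ) * k x y ∂μ :=
    Measurable.lintegral_prod_right' (f := fun z : X × X => u z.1 ^ (2 : ℝ) * k z.1 z.2)
      (((hu.pow_const _).comp measurable_fst).mul hk)
  calc _ ≤ ∫⁻ x, ∫⁻ y, 2⁻¹ * (u x ^ (2 : ℝ) * k x y + u y ^ (2 : ℝ) * k x y) ∂μ ∂μ := by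
        refine lintegral_mono fun x => lintegral_mono fun y => ?_
        refine (mul_le_mul_left (hY (u x) (u y)) _).trans (le_of_eq ?_)
        ring
    _ = 2⁻¹ * ((∫⁻ x, ∫⁻ y, u x ^ (2 : ℝ) * k x y ∂μ ∂μ) +
          ∫⁻ x, ∫⁻ y, u y ^ (2 : ℝ) * k x y ∂μ ∂μ) := by
        rw [← lintegral_add_left hAm, ← lintegral_const_mul' _ _ (by simp)]
        refine lintegral_congr fun x => ?_
        rw [lintegral_const_mul' _ _ (by simp), lintegral_add_left]
        exact (hk.comp measurable_prodMk_left).const_mul _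
    _ ≤ 2⁻¹ * ((∫⁻ x, u x ^ (2 : ℝ) ∂μ) + ∫⁻ x, u x ^ (2 : ℝ) ∂μ) := by gcongr
    _ = _ := by
        rw [← two_mul, ← mul_assoc, ENNReal.inv_mul_cancel (by simp) (by simp), one_mul]

lemma measurable_schrodingerKernel (ε : ℝ) :
    Measurable fun z : (Fin d → ℝ) × ℝ => schrodingerKernel ε z.1 z.2 := by
  refine (StronglyMeasurable.integral_prod_right (f := fun (z : (Fin d → ℝ) × ℝ) ξ =>
    (gaussianCutoff ε ξ : ℂ) * planeWave ξ z.1 z.2) ?_).measurable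
  refine Measurable.stronglyMeasurable (Measurable.mul ?_ ?_)
  · exact Complex.measurable_ofReal.comp
        ((continuous_gaussianCutoff ε).measurable.comp measurable_snd)
  · exact measurable_planeWave measurable_snd measurable_fst.fst measurable_fst.snd

/-- Bessel's inequality for the Fourier transform. -/
theorem lintegral_waveTransform_sq_le (hfm : Measurable f) (hf : Integrable f) (t : ℝ) :
    ∫⁻ ξ, ‖waveTransform t f ξ‖ₑ ^ (2 : ℝ) ≤ ∫⁻ x, ‖f x‖ₑ ^ (2 : ℝ) := by
  refine lintegral_le_of_gaussianCutoff ((measurable_waveTransform hfm t).enorm.pow_const _)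
    fun ε hε => ?_
  have hm : Measurable (Function.uncurry fun x ξ : Fin d → ℝ => f x * planeWave ξ x t) :=
    (hfm.comp measurable_fst).mul
        (measurable_planeWave measurable_snd measurable_fst measurable_const)
  refine (lintegral_weight_mul_enorm_integral_sq_le
      (h := fun x ξ => f x * planeWave ξ x t) hm hf.norm
    (fun x ξ => by simp) (integrable_gaussianCutoff hε) (continuous_gaussianCutoff ε).measurable
    fun ξ => (gaussianCutoff_pos ε ξ).le).trans ?_
  have hk : Measurable fun z : (Fin d → ℝ) × (Fin d → ℝ) => ‖schrodingerKernel ε (z.1 - z.2) 0‖ₑ :=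
    ((measurable_schrodingerKernel ε).comp
      ((measurable_fst.sub measurable_snd).prodMk measurable_const)).enorm
  refine le_trans (le_of_eq ?_) (lintegral_lintegral_mul_le hfm.enorm
    (k := fun x y => ‖schrodingerKernel ε (x - y) 0‖ₑ) hk (fun x => ?_) (fun y => ?_))
  · refine lintegral_congr fun x => lintegral_congr fun y => ?_
    rw [← enorm_mul, show ‖f x * f y‖ₑ = ‖f x * conj (f y)‖ₑ by simp [enorm_mul], ← enorm_mul,
        schrodingerKernel,
      ← integral_const_mul]
    congr 2 with ξ
    rw [map_mul, ← sub_self t, ← planeWave_mul_conj]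
    ring
  · rw [lintegral_sub_left_eq_self (fun z => ‖schrodingerKernel ε z 0‖ₑ),
      lintegral_enorm_schrodingerKernel_zero hε]
  · rw [lintegral_sub_right_eq_self (fun z => ‖schrodingerKernel ε z 0‖ₑ),
      lintegral_enorm_schrodingerKernel_zero hε]

lemma integrable_cutoff_waveTransform {ε : ℝ} (hε : 0 < ε) (hgm : Measurable g) (s : ℝ) :
    Integrable fun ξ => (gaussianCutoff ε ξ : ℂ) * conj (waveTransform s g ξ) :=
  (integrable_gaussianCutoff hε).ofReal.mul_bdd (c := ∫ x, ‖g x‖)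
    (Complex.continuous_conj.measurable.comp (measurable_waveTransform hgm s)).aestronglyMeasurable
    (ae_of_all _ fun ξ => by simpa using norm_waveTransform_le s ξ)

lemma measurable_regularizedEvolution (hgm : Measurable g) (ε t s : ℝ) :
    Measurable (regularizedEvolution ε t s g) := by
  refine (StronglyMeasurable.integral_prod_right (f := fun (x ξ : Fin d → ℝ) =>
    (gaussianCutoff ε ξ : ℂ) * conj (waveTransform s g ξ) * planeWave ξ x t) ?_).measurable
  refine Measurable.stronglyMeasurable (Measurable.mul (Measurable.mul ?_ ?_) ?_)
  · exact Complex.measurable_ofReal.comp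
        ((continuous_gaussianCutoff ε).measurable.comp measurable_snd)
  · exact Complex.continuous_conj.measurable.comp
        ((measurable_waveTransform hgm s).comp measurable_snd)
  · exact measurable_planeWave measurable_snd measurable_fst measurable_const

lemma lintegral_regularizedEvolution_sq_le {ε : ℝ} (hε : 0 < ε) (hgm : Measurable g)
    (hg : Integrable g) (t s : ℝ) :
    ∫⁻ x, ‖regularizedEvolution ε t s g x‖ₑ ^ (2 : ℝ) ≤ ∫⁻ x, ‖g x‖ₑ ^ (2 : ℝ) := by
  have hi := integrable_mul_planeWave_frequency (integrable_cutoff_waveTransform hε hgm s) 0 t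
  have hm : Measurable fun ξ : Fin d → ℝ => (gaussianCutoff ε ξ : ℂ) * conj (waveTransform s g ξ) *
      planeWave ξ 0 t :=
    ((Complex.measurable_ofReal.comp (continuous_gaussianCutoff ε).measurable).mul
      (Complex.continuous_conj.measurable.comp (measurable_waveTransform hgm s))).mul
      (measurable_planeWave measurable_id measurable_const measurable_const)
  calc _ = ∫⁻ x, ‖waveTransform 0 (fun ξ : Fin d → ℝ => (gaussianCutoff ε ξ : ℂ) *
        conj (waveTransform s g ξ) * planeWave ξ 0 t) x‖ₑ ^ (2 : ℝ) := by
        refine lintegral_congr fun x => ?_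
        rw [regularizedEvolution]
        unfold waveTransform
        congr 3 with ξ
        rw [mul_assoc _ (planeWave ξ 0 t)]
        congr 1
        unfold planeWave
        rw [← Complex.exp_add]
        congr 1
        simp only [Pi.zero_apply, zero_mul, Finset.sum_const_zero]
        rw [Finset.sum_congr rfl fun j _ => mul_comm (x j) (ξ j)]
        push_cast
        ring
    _ ≤ _ := lintegral_waveTransform_sq_le hm hi 0
    _ ≤ ∫⁻ ξ, ‖waveTransform s g ξ‖ₑ ^ (2 : ℝ) := by
        refine lintegral_mono fun ξ => ?_
        gcongr
        rw [← ofReal_norm, ← ofReal_norm]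
        apply ENNReal.ofReal_le_ofReal
        simp only [norm_mul, norm_planeWave, mul_one, RCLike.norm_conj, Complex.norm_real,
          Real.norm_of_nonneg (gaussianCutoff_pos ε ξ).le]
        exact mul_le_of_le_one_left (norm_nonneg _) (gaussianCutoff_le_one hε ξ)
    _ ≤ _ := lintegral_waveTransform_sq_le hgm hg s

lemma regularizedEvolution_eq_integral_kernel {ε : ℝ} (hε : 0 < ε) (hgm : Measurable g)
    (hg : Integrable g) (t s : ℝ) (x : Fin d → ℝ) :
    regularizedEvolution ε t s g x = ∫ y, conj (g y) * schrodingerKernel ε (x - y) (t - s) := by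
  have hint : Integrable (Function.uncurry fun ξ y : Fin d → ℝ =>
      (gaussianCutoff ε ξ : ℂ) * (conj (g y) * planeWave ξ (x - y) (t - s))) (volume.prod volume)
          := by
    refine Integrable.mono' ((integrable_gaussianCutoff hε).mul_prod hg.norm) ?_
      (ae_of_all _ fun ⟨ξ, y⟩ => ?_)
    · refine Measurable.aestronglyMeasurable (Measurable.mul ?_ (Measurable.mul ?_ ?_))
      · exact Complex.measurable_ofReal.comp
            ((continuous_gaussianCutoff ε).measurable.comp measurable_fst)
      · exact Complex.continuous_conj.measurable.comp (hgm.comp measurable_snd)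
      · exact measurable_planeWave measurable_fst
            (measurable_const.sub measurable_snd) measurable_const
    · simp [Function.uncurry, Real.norm_of_nonneg (gaussianCutoff_pos ε ξ).le]
  calc _ = ∫ ξ, ∫ y, (gaussianCutoff ε ξ : ℂ) * (conj (g y) * planeWave ξ (x - y) (t - s)) := by
        unfold regularizedEvolution waveTransform
        congr 1 with ξ
        rw [integral_const_mul, mul_assoc, ← integral_conj, ← integral_mul_const]
        congr 2 with y
        rw [← planeWave_mul_conj, map_mul]
        ring
    _ = ∫ y, ∫ ξ, (gaussianCutoff ε ξ : ℂ) * (conj (g y) * planeWave ξ (x - y) (t - s)) :=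
        integral_integral_swap hint
    _ = _ := by
        congr 1 with y
        rw [schrodingerKernel, ← integral_const_mul]
        congr 1 with ξ
        ring

lemma enorm_regularizedEvolution_le {ε : ℝ} (hε : 0 < ε) (hgm : Measurable g)
    (hg : Integrable g) {t s : ℝ} (hts : t ≠ s) (x : Fin d → ℝ) :
    ‖regularizedEvolution ε t s g x‖ₑ ≤
      ENNReal.ofReal ((4 * Real.pi * |t - s|) ^ (-((d : ℝ) / 2))) * ∫⁻ y, ‖g y‖ₑ := by
  rw [regularizedEvolution_eq_integral_kernel hε hgm hg]
  refine (enorm_integral_le_lintegral_enorm _).trans ?_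
  rw [← lintegral_const_mul _ hgm.enorm]
  refine lintegral_mono fun y => ?_
  rw [enorm_mul, mul_comm]
  gcongr
  · rw [← ofReal_norm]
    exact ENNReal.ofReal_le_ofReal (norm_schrodingerKernel_le hε _ (sub_ne_zero.2 hts))
  · simp

lemma regularizedEvolution_add {ε : ℝ} (hε : 0 < ε) {g₁ g₂ : (Fin d → ℝ) → ℂ}
    (hm₁ : Measurable g₁) (hm₂ : Measurable g₂) (h₁ : Integrable g₁) (h₂ : Integrable g₂) (t s : ℝ)
        :
    regularizedEvolution ε t s (g₁ + g₂) =
      regularizedEvolution ε t s g₁ + regularizedEvolution ε t s g₂ := by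
  ext x
  have hw : ∀ ξ, waveTransform s (g₁ + g₂) ξ = waveTransform s g₁ ξ + waveTransform s g₂ ξ := by
    intro ξ
    unfold waveTransform
    rw [← integral_add (integrable_mul_planeWave h₁ ξ s) (integrable_mul_planeWave h₂ ξ s)]
    simp [add_mul]
  rw [Pi.add_apply]
  unfold regularizedEvolution
  rw [← integral_add (integrable_mul_planeWave_frequency
      (integrable_cutoff_waveTransform hε hm₁ s) x t)
    (integrable_mul_planeWave_frequency (integrable_cutoff_waveTransform hε hm₂ s) x t)]
  congr 1 with ξ
  rw [hw, map_add]; ring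

lemma integral_cutoff_waveTransform_mul {ε : ℝ} (hε : 0 < ε) (hfm : Measurable f)
    (hf : Integrable f) (hgm : Measurable g) (t s : ℝ) :
    ∫ ξ, (gaussianCutoff ε ξ : ℂ) * (waveTransform t f ξ * conj (waveTransform s g ξ)) =
      ∫ x, f x * regularizedEvolution ε t s g x := by
  have hint : Integrable (Function.uncurry fun ξ x : Fin d → ℝ =>
      ((gaussianCutoff ε ξ : ℂ) * conj (waveTransform s g ξ)) * (f x * planeWave ξ x t))
      (volume.prod volume) := by
    have hi := integrable_cutoff_waveTransform hε hgm s
    refine Integrable.mono' (hi.norm.mul_prod hf.norm) ?_ (ae_of_all _ fun ⟨ξ, x⟩ => ?_)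
    · refine (hi.aestronglyMeasurable.comp_fst).mul
        (Measurable.aestronglyMeasurable (Measurable.mul ?_ ?_))
      · exact hfm.comp measurable_snd
      · exact measurable_planeWave measurable_fst measurable_snd measurable_const
    · simp [Function.uncurry]
  calc _ = ∫ ξ, ∫ x, ((gaussianCutoff ε ξ : ℂ) * conj (waveTransform s g ξ)) *
          (f x * planeWave ξ x t) := by
        congr 1 with ξ
        rw [integral_const_mul, waveTransform]
        ring
    _ = ∫ x, ∫ ξ, ((gaussianCutoff ε ξ : ℂ) * conj (waveTransform s g ξ)) *
          (f x * planeWave ξ x t) := integral_integral_swap hint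
    _ = _ := by
        congr 1 with x
        rw [regularizedEvolution, ← integral_const_mul]
        congr 1 with ξ
        ring

end

/-- The dispersive estimate in bilinear form, uniformly in the regularization. -/
theorem enorm_integral_cutoff_waveTransform_le {d : ℕ} (hd : 1 ≤ d) {p q : ℝ}
    (hp : p = 2 * (d + 2) / d) (hq : q = p / (p - 1)) :
    ∃ C : ℝ≥0, ∀ (ε t s : ℝ) (f g : (Fin d → ℝ) → ℂ), 0 < ε → t ≠ s → Measurable f → Integrable f →
      Measurable g → Integrable g →
      ‖∫ ξ, (gaussianCutoff ε ξ : ℂ) * (waveTransform t f ξ * conj (waveTransform s g ξ))‖ₑ ≤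
        C * (ENNReal.ofReal (|t - s| ^ (-((d : ℝ) / (d + 2)))) *
          ((∫⁻ x, ‖f x‖ₑ ^ q) ^ (1 / q) * (∫⁻ x, ‖g x‖ₑ ^ q) ^ (1 / q))) := by
  have hd0 : (0 : ℝ) < d := by exact_mod_cast hd
  have hp2 : 2 < p := by rw [hp, lt_div_iff₀ hd0]; linarith
  have hp1 : 0 < p - 1 := by linarith
  have hp0 : 0 < p := by linarith
  have hqp : q.HolderConjugate p := by rw [hq]; exact
      (Real.HolderConjugate.conjExponent (by linarith)).symm
  obtain ⟨C, hC⟩ := marcinkiewicz_one_two (X := Fin d → ℝ) (μ := volume) hp2 hq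
  refine ⟨C ^ (1 / p) * Real.toNNReal ((4 * Real.pi) ^ (-((d : ℝ) / (d + 2)))),
    fun ε t s f g hε hts hfm hf hgm hg => ?_⟩
  have hτ : 0 < |t - s| := abs_pos.2 (sub_ne_zero.2 hts)
  have hπ := Real.pi_pos
  set D : ℝ := (4 * Real.pi * |t - s|) ^ (-((d : ℝ) / 2)) with hD
  have hD0 : 0 < D := by positivity
  have hS := measurable_regularizedEvolution hgm ε t s
  have key := hC g (regularizedEvolution ε t s g) D hgm hS hD0 fun A hA => by
    have hm₁ := hgm.indicator hA
    have hm₂ := hgm.indicator hA.compl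
    have hi₁ := hg.indicator hA
    have hi₂ := hg.indicator hA.compl
    refine ⟨regularizedEvolution ε t s (A.indicator g), regularizedEvolution ε t s (Aᶜ.indicator g),
      ?_, measurable_regularizedEvolution hm₂ ε t s, fun x => ?_, ?_⟩
    · rw [← regularizedEvolution_add hε hm₁ hm₂ hi₁ hi₂, Set.indicator_self_add_compl]
    · refine (enorm_regularizedEvolution_le hε hm₁ hi₁ hts x).trans_eq ?_
      rw [← lintegral_indicator hA]
      simp_rw [hD, enorm_indicator_eq_indicator_enorm]
    · refine (lintegral_regularizedEvolution_sq_le hε hm₂ hi₂ t s).trans_eq ?_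
      rw [← lintegral_indicator hA.compl]
      refine lintegral_congr fun x => ?_
      by_cases hx : x ∈ Aᶜ <;> simp [hx]
  rw [integral_cutoff_waveTransform_mul hε hfm hf hgm]
  refine (enorm_integral_le_lintegral_enorm _).trans ?_
  simp_rw [enorm_mul]
  refine (ENNReal.lintegral_mul_le_Lp_mul_Lq volume hqp hfm.enorm.aemeasurable
    hS.enorm.aemeasurable).trans ?_
  have hpow : (∫⁻ x, ‖regularizedEvolution ε t s g x‖ₑ ^ p) ^ (1 / p) ≤
      (C ^ (1 / p) : ℝ≥0) * (ENNReal.ofReal ((4 * Real.pi) ^ (-((d : ℝ) / (d + 2)))) *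
        ENNReal.ofReal (|t - s| ^ (-((d : ℝ) / (d + 2))))) * (∫⁻ x, ‖g x‖ₑ ^ q) ^ (1 / q) := by
    refine (ENNReal.rpow_le_rpow key (by positivity)).trans_eq ?_
    rw [ENNReal.mul_rpow_of_nonneg _ _ (by positivity),
        ENNReal.mul_rpow_of_nonneg _ _ (by positivity),
      ← ENNReal.rpow_mul, ← ENNReal.coe_rpow_of_nonneg _ (by positivity)]
    congr 2
    · rw [ENNReal.ofReal_rpow_of_nonneg (by positivity) (by positivity),
        ← ENNReal.ofReal_mul (by positivity), ← Real.mul_rpow (by positivity) (by positivity), hD,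
        ← Real.rpow_mul (by positivity), ← Real.rpow_mul (by positivity)]
      congr 2
      rw [hp]; field_simp; ring
    · rw [hq]; field_simp
  calc _ ≤ _ := mul_le_mul_right hpow _
    _ = _ := by
      rw [ENNReal.coe_mul, ENNReal.ofReal]
      ring

/-- The Fourier restriction estimate for the paraboloid (dual Strichartz inequality). -/
theorem lintegral_integral_waveTransform_sq_le {d : ℕ} (hd : 1 ≤ d) {p q : ℝ}
    (hp : p = 2 * (d + 2) / d) (hq : q = p / (p - 1)) :
    ∃ C : ℝ≥0, ∀ F : ℝ → (Fin d → ℝ) → ℂ, Measurable (Function.uncurry F) →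
      (∀ t, Integrable (F t)) → Integrable (Function.uncurry F) →
      ∫⁻ ξ, ‖∫ t, waveTransform t (F t) ξ‖ₑ ^ (2 : ℝ) ≤
        C * (∫⁻ t, ∫⁻ x, ‖F t x‖ₑ ^ q) ^ (2 / q) := by
  have hd0 : (0 : ℝ) < d := by exact_mod_cast hd
  have hq' : q = 2 / (2 - (d : ℝ) / (d + 2)) := by
    rw [hq, hp]; field_simp
  have hq0 : q ≠ 0 := by
    rw [hq']
    have : (d : ℝ) / (d + 2) < 1 := by rw [div_lt_one (by positivity)]; linarith
    exact (div_pos two_pos (by linarith)).ne'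
  obtain ⟨C, hC⟩ := enorm_integral_cutoff_waveTransform_le hd hp hq
  obtain ⟨C', hC'⟩ := hardy_littlewood_sobolev_self (α := (d : ℝ) / (d + 2)) (by positivity)
    (by rw [div_lt_one (by positivity)]; linarith) hq'
  refine ⟨C * C', fun F hFm hFt hF => ?_⟩
  have hm : Measurable (Function.uncurry fun t ξ => waveTransform t (F t) ξ) :=
    measurable_waveTransform_uncurry hFm
  have hFtm : ∀ t, Measurable (F t) := fun t => hFm.of_uncurry_left
  refine lintegral_le_of_gaussianCutoff ?_ fun ε hε => ?_
  · refine Measurable.pow_const (Measurable.enorm ?_) _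
    exact (StronglyMeasurable.integral_prod_left (f := fun t ξ => waveTransform t (F t) ξ)
      hm.stronglyMeasurable).measurable
  refine (lintegral_weight_mul_enorm_integral_sq_le hm hF.integral_norm_prod_left
    (fun t ξ => norm_waveTransform_le t ξ) (integrable_gaussianCutoff hε)
    (continuous_gaussianCutoff ε).measurable fun ξ => (gaussianCutoff_pos ε ξ).le).trans ?_
  set φ : ℝ → ℝ≥0∞ := fun t => (∫⁻ x, ‖F t x‖ₑ ^ q) ^ (1 / q) with hφ
  have hφm : Measurable φ :=
    (Measurable.lintegral_prod_right' (f := fun z : ℝ × (Fin d → ℝ) => ‖F z.1 z.2‖ₑ ^ q)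
      (hFm.enorm.pow_const _)).pow_const _
  calc _ ≤ ∫⁻ s, ∫⁻ t, C * (ENNReal.ofReal (|s - t| ^ (-((d : ℝ) / (d + 2)))) * (φ s * φ t)) := by
        refine lintegral_mono fun s => lintegral_mono_ae ?_
        filter_upwards [Measure.ae_ne volume s] with t hts
        exact hC ε s t (F s) (F t) hε hts.symm (hFtm s) (hFt s) (hFtm t) (hFt t)
    _ = C * ∫⁻ s, ∫⁻ t, ENNReal.ofReal (|s - t| ^ (-((d : ℝ) / (d + 2)))) * (φ s * φ t) := by
        simp_rw [lintegral_const_mul' _ _ (ENNReal.coe_ne_top (r := C))]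
    _ ≤ C * (C' * (∫⁻ t, φ t ^ q) ^ (2 / q)) := by gcongr; exact hC' φ hφm
    _ = _ := by
        rw [ENNReal.coe_mul, mul_assoc]
        simp_rw [hφ, ← ENNReal.rpow_mul, one_div_mul_cancel hq0, ENNReal.rpow_one]

/-- The Schrödinger evolution with frequency data `g`. -/
noncomputable def waveExtension {d : ℕ} (g : (Fin d → ℝ) → ℂ) (t : ℝ) (x : Fin d → ℝ) : ℂ :=
  ∫ ξ, g ξ * planeWave ξ x t

section
variable {d : ℕ} {g : (Fin d → ℝ) → ℂ}

lemma norm_waveExtension_le (t : ℝ) (x : Fin d → ℝ) : ‖waveExtension g t x‖ ≤ ∫ ξ, ‖g ξ‖ :=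
  (norm_integral_le_integral_norm _).trans (by simp)

lemma measurable_waveExtension (hg : Measurable g) {X : Type*} [MeasurableSpace X] {t : X → ℝ}
    {x : X → Fin d → ℝ} (ht : Measurable t) (hx : Measurable x) :
    Measurable fun a => waveExtension g (t a) (x a) := by
  refine (StronglyMeasurable.integral_prod_right (f := fun a ξ =>
    g ξ * planeWave ξ (x a) (t a)) ?_).measurable
  exact ((hg.comp measurable_snd).mul (measurable_planeWave measurable_snd
    (hx.comp measurable_fst) (ht.comp measurable_fst))).stronglyMeasurable

lemma integral_mul_waveExtension (hgm : Measurable g) (hg : Integrable g)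
    {F : ℝ → (Fin d → ℝ) → ℂ} (hFm : Measurable (Function.uncurry F))
    (hF : Integrable (Function.uncurry F)) :
    ∫ z : ℝ × (Fin d → ℝ), F z.1 z.2 * waveExtension g z.1 z.2 =
      ∫ ξ, g ξ * ∫ t, waveTransform t (F t) ξ := by
  have hint : Integrable (Function.uncurry fun (z : ℝ × (Fin d → ℝ)) ξ =>
      g ξ * (F z.1 z.2 * planeWave ξ z.2 z.1)) (volume.prod volume) := by
    refine Integrable.mono' (hF.norm.mul_prod hg.norm) ?_ (ae_of_all _ fun ⟨z, ξ⟩ => ?_)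
    · exact ((hgm.comp measurable_snd).mul ((hFm.comp measurable_fst).mul
        (measurable_planeWave measurable_snd measurable_fst.snd
          measurable_fst.fst))).aestronglyMeasurable
    · simp [Function.uncurry, mul_comm]
  calc _ = ∫ z : ℝ × (Fin d → ℝ), ∫ ξ, g ξ * (F z.1 z.2 * planeWave ξ z.2 z.1) := by
        congr 1 with z
        rw [waveExtension, ← integral_const_mul]
        congr 1 with ξ
        ring
    _ = ∫ ξ, ∫ z : ℝ × (Fin d → ℝ), g ξ * (F z.1 z.2 * planeWave ξ z.2 z.1) :=
        integral_integral_swap hint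
    _ = _ := by
        congr 1 with ξ
        rw [integral_const_mul]
        congr 1
        refine integral_prod (fun z : ℝ × (Fin d → ℝ) => F z.1 z.2 * planeWave ξ z.2 z.1)
          (Integrable.mul_bdd (c := 1) hF ?_ (ae_of_all _ fun z => by simp))
        exact (measurable_planeWave measurable_const measurable_snd
          measurable_fst).aestronglyMeasurable

end

/-- The Fourier extension estimate for the paraboloid, for integrable frequency data. -/
theorem lintegral_waveExtension_rpow_le {d : ℕ} (hd : 1 ≤ d) {p : ℝ}
    (hp : p = 2 * (d + 2) / d) :
    ∃ C : ℝ≥0, ∀ g : (Fin d → ℝ) → ℂ, Measurable g → Integrable g →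
      ∫⁻ z : ℝ × (Fin d → ℝ), ‖waveExtension g z.1 z.2‖ₑ ^ p ≤
        (C * (∫⁻ ξ, ‖g ξ‖ₑ ^ (2 : ℝ)) ^ (1 / 2 : ℝ)) ^ p := by
  have hd0 : (0 : ℝ) < d := by exact_mod_cast hd
  have hp2 : 2 < p := by rw [hp, lt_div_iff₀ hd0]; linarith
  have hp1 : 0 < p - 1 := by linarith
  have hp0 : 0 < p := by linarith
  set q : ℝ := p / (p - 1) with hq
  have hq0 : 0 < q := by positivity
  obtain ⟨C, hC⟩ := lintegral_integral_waveTransform_sq_le hd hp hq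
  refine ⟨C ^ (1 / 2 : ℝ), fun g hgm hg => ?_⟩
  set N : ℝ≥0∞ := (∫⁻ ξ, ‖g ξ‖ₑ ^ (2 : ℝ)) ^ (1 / 2 : ℝ)
  set u : ℝ × (Fin d → ℝ) → ℂ := fun z => waveExtension g z.1 z.2
  set M : ℝ := ∫ ξ, ‖g ξ‖
  have hM0 : 0 ≤ M := integral_nonneg fun _ => norm_nonneg _
  have hum : Measurable u := measurable_waveExtension hgm measurable_fst measurable_snd
  have huM : ∀ z, ‖u z‖ ≤ M := fun z => norm_waveExtension_le z.1 z.2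
  set S : ℕ → Set (ℝ × (Fin d → ℝ)) := fun n => Metric.closedBall 0 n ×ˢ Metric.closedBall 0 n
  have hSm : ∀ n, MeasurableSet (S n) := fun n =>
      measurableSet_closedBall.prod measurableSet_closedBall
  have hSfin : ∀ n, volume (S n) < ∞ := fun n =>
    ((isCompact_closedBall 0 (n : ℝ)).prod (isCompact_closedBall 0 (n : ℝ))).measure_lt_top
  have hSU : ⋃ n, S n = Set.univ := by
    refine Set.eq_univ_of_forall fun z => Set.mem_iUnion.2 ?_
    obtain ⟨n, hn⟩ := exists_nat_ge (max ‖z.1‖ ‖z.2‖)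
    exact ⟨n, by simpa using (le_max_left _ _).trans hn, by simpa using (le_max_right _ _).trans hn⟩
  have hSdir : Directed (· ⊆ ·) S := by
    refine directed_of_isDirected_le fun m n hmn => ?_
    have : (m : ℝ) ≤ n := by exact_mod_cast hmn
    exact Set.prod_mono (Metric.closedBall_subset_closedBall this)
      (Metric.closedBall_subset_closedBall this)
  suffices h : ∀ n, ∫⁻ z in S n, ‖u z‖ₑ ^ p ≤ ((C ^ (1 / 2 : ℝ) : ℝ≥0) * N) ^ p by
    rw [← setLIntegral_univ, ← hSU, setLIntegral_iUnion_of_directed _ hSdir]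
    exact iSup_le h
  intro n
  set W := ∫⁻ z in S n, ‖u z‖ₑ ^ p with hW
  have hWtop : W ≠ ∞ := by
    refine (setLIntegral_lt_top_of_le_nnreal (hSfin n).ne ⟨(M ^ p).toNNReal, fun z _ => ?_⟩).ne
    rw [← ofReal_norm, ENNReal.ofReal_rpow_of_nonneg (norm_nonneg _) hp0.le]
    exact ENNReal.ofReal_le_ofReal (Real.rpow_le_rpow (norm_nonneg _) (huM z) hp0.le)
  set F : ℝ → (Fin d → ℝ) → ℂ := fun t x =>
    (S n).indicator (fun z => conj (u z) * ((‖u z‖ ^ (p - 2) : ℝ) : ℂ)) (t, x)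
  have hFm : Measurable (Function.uncurry F) :=
    ((Complex.continuous_conj.measurable.comp hum).mul
      (Complex.measurable_ofReal.comp (hum.norm.pow_const _))).indicator (hSm n)
  have hpow : ∀ z, ‖conj (u z) * ((‖u z‖ ^ (p - 2) : ℝ) : ℂ)‖ = ‖u z‖ ^ (p - 1) := by
    intro z
    rw [norm_mul, RCLike.norm_conj, Complex.norm_real, Real.norm_of_nonneg (by positivity)]
    nth_rw 1 [← Real.rpow_one ‖u z‖]
    rw [← Real.rpow_add_of_nonneg (norm_nonneg _) zero_le_one (by linarith)]
    congr 1; ring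
  have hFle : ∀ z, ‖Function.uncurry F z‖ ≤ (S n).indicator (fun _ => M ^ (p - 1)) z := by
    intro z
    by_cases hz : z ∈ S n
    · simp only [Function.uncurry, F, Set.indicator_of_mem hz, hpow]
      exact Real.rpow_le_rpow (norm_nonneg _) (huM z) hp1.le
    · simp [Function.uncurry, F, hz]
  have hF : Integrable (Function.uncurry F) :=
    Integrable.mono' ((integrable_indicator_iff (hSm n)).2 (integrableOn_const (hSfin n).ne))
      hFm.aestronglyMeasurable (ae_of_all _ hFle)
  have hFt : ∀ t, Integrable (F t) := by
    intro t
    refine Integrable.mono' (g := (Metric.closedBall 0 n).indicator fun _ => M ^ (p - 1))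
      ((integrable_indicator_iff measurableSet_closedBall).2
        (integrableOn_const measure_closedBall_lt_top.ne))
      hFm.of_uncurry_left.aestronglyMeasurable (ae_of_all _ fun x => (hFle (t, x)).trans ?_)
    by_cases hx : x ∈ Metric.closedBall 0 (n : ℝ)
    · rw [Set.indicator_of_mem hx]
      exact Set.indicator_le_self' (fun _ _ => by positivity) _
    · rw [Set.indicator_of_notMem hx, Set.indicator_of_notMem fun h => hx h.2]
  have hFW : ∫⁻ t, ∫⁻ x, ‖F t x‖ₑ ^ q = W := by
    rw [← lintegral_prod (fun z : ℝ × (Fin d → ℝ) => ‖F z.1 z.2‖ₑ ^ q)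
      (hFm.enorm.pow_const _).aemeasurable, hW, ← lintegral_indicator (hSm n)]
    refine lintegral_congr fun z => ?_
    by_cases hz : z ∈ S n
    · simp only [F, Set.indicator_of_mem hz]
      rw [← ofReal_norm, hpow, ← ofReal_norm, ENNReal.ofReal_rpow_of_nonneg (by positivity) hq0.le,
        ENNReal.ofReal_rpow_of_nonneg (by positivity) hp0.le, ← Real.rpow_mul (norm_nonneg _)]
      congr 2
      rw [hq]; field_simp
    · simp [F, hz, hq0]
  have hWF : W = ‖∫ z : ℝ × (Fin d → ℝ), F z.1 z.2 * waveExtension g z.1 z.2‖ₑ := by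
    have h1 : ∀ z : ℝ × (Fin d → ℝ), F z.1 z.2 * waveExtension g z.1 z.2 =
        (((S n).indicator (fun z => ‖u z‖ ^ p) z : ℝ) : ℂ) := by
      intro z
      by_cases hz : z ∈ S n
      · simp only [F, Set.indicator_of_mem hz]
        rw [show waveExtension g z.1 z.2 = u z from rfl, mul_right_comm, Complex.conj_mul',
          ← Complex.ofReal_pow, ← Complex.ofReal_mul, ← Real.rpow_natCast,
          ← Real.rpow_add_of_nonneg (norm_nonneg _) (by norm_num) (by linarith)]
        congr 2; push_cast; ring
      · simp [F, hz]
    have h2 : Integrable ((S n).indicator fun z => ‖u z‖ ^ p) := by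
      refine Integrable.mono' (g := (S n).indicator fun _ => M ^ p)
        ((integrable_indicator_iff (hSm n)).2 (integrableOn_const (hSfin n).ne))
        ((hum.norm.pow_const _).indicator (hSm n)).aestronglyMeasurable (ae_of_all _ fun z => ?_)
      by_cases hz : z ∈ S n
      · simp only [Set.indicator_of_mem hz]
        rw [Real.norm_of_nonneg (by positivity)]
        exact Real.rpow_le_rpow (norm_nonneg _) (huM z) hp0.le
      · simp [hz]
    have h3 : ∀ z, 0 ≤ (S n).indicator (fun z => ‖u z‖ ^ p) z :=
      fun z => Set.indicator_nonneg (fun _ _ => by positivity) z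
    simp_rw [h1]
    rw [integral_complex_ofReal, ← ofReal_norm, Complex.norm_real,
      Real.norm_of_nonneg (integral_nonneg h3), ofReal_integral_eq_lintegral_ofReal h2
          (ae_of_all _ h3),
      hW, ← lintegral_indicator (hSm n)]
    refine lintegral_congr fun z => ?_
    by_cases hz : z ∈ S n
    · simp only [Set.indicator_of_mem hz]
      rw [← ofReal_norm, ENNReal.ofReal_rpow_of_nonneg (norm_nonneg _) hp0.le]
    · simp [hz]
  have hHm : Measurable fun ξ => ∫ t, waveTransform t (F t) ξ :=
    (StronglyMeasurable.integral_prod_left (f := fun t ξ => waveTransform t (F t) ξ)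
      (measurable_waveTransform_uncurry hFm).stronglyMeasurable).measurable
  have hWle : W ≤ ((C ^ (1 / 2 : ℝ) : ℝ≥0) * N) * W ^ (1 / q) := by
    calc W ≤ ∫⁻ ξ, ‖g ξ‖ₑ * ‖∫ t, waveTransform t (F t) ξ‖ₑ := by
          rw [hWF, integral_mul_waveExtension hgm hg hFm hF]
          refine (enorm_integral_le_lintegral_enorm _).trans_eq ?_
          simp_rw [enorm_mul]
      _ ≤ N * (∫⁻ ξ, ‖∫ t, waveTransform t (F t) ξ‖ₑ ^ (2 : ℝ)) ^ (1 / 2 : ℝ) :=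
          ENNReal.lintegral_mul_le_Lp_mul_Lq volume Real.HolderConjugate.two_two
            hgm.enorm.aemeasurable hHm.enorm.aemeasurable
      _ ≤ N * (C * W ^ (2 / q)) ^ (1 / 2 : ℝ) := by
          rw [← hFW]
          gcongr
          exact hC F hFm hFt hF
      _ = _ := by
          rw [ENNReal.mul_rpow_of_nonneg _ _ (by positivity), ← ENNReal.rpow_mul,
            ENNReal.coe_rpow_of_nonneg _ (by positivity), show 2 / q * (1 / 2) = 1 / q by ring]
          ring
  rcases eq_or_ne W 0 with h0 | h0
  · rw [h0]; exact zero_le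
  have hsplit : W = W ^ (1 / p) * W ^ (1 / q) := by
    rw [← ENNReal.rpow_add _ _ h0 hWtop, hq]
    nth_rw 1 [← ENNReal.rpow_one W]
    congr 1; field_simp; ring
  have hfin : W ^ (1 / p) ≤ (C ^ (1 / 2 : ℝ) : ℝ≥0) * N := by
    have hW0 : W ^ (1 / q) ≠ 0 := by simp [h0, hWtop]
    have hWt : W ^ (1 / q) ≠ ∞ := ENNReal.rpow_ne_top_of_nonneg (by positivity) hWtop
    exact (ENNReal.mul_le_mul_iff_left hW0 hWt).1 (hsplit.symm.trans_le hWle)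
  calc W = (W ^ (1 / p)) ^ p := by
        rw [← ENNReal.rpow_mul, one_div_mul_cancel hp0.ne', ENNReal.rpow_one]
    _ ≤ _ := ENNReal.rpow_le_rpow hfin hp0.le

lemma fourier_integral_eq_waveExtension {d : ℕ} (f : (Fin d → ℝ) → ℂ) (z : (Fin d → ℝ) × ℝ) :
    (∫ ξ : Fin d → ℝ,
      (∫ y : Fin d → ℝ, f y *
        Complex.exp (-(2 * Real.pi * Complex.I) * ((∑ j, y j * ξ j : ℝ) : ℂ))) *
      Complex.exp (2 * Real.pi * Complex.I * ((∑ j, z.1 j * ξ j : ℝ) : ℂ)) *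
      Complex.exp (-(4 * (Real.pi : ℂ) ^ 2 * Complex.I) *
        (((∑ j, ξ j ^ 2) * z.2 : ℝ) : ℂ))) =
      waveExtension (fun ξ => waveTransform 0 f (-ξ)) z.2 z.1 := by
  unfold waveExtension
  congr 1 with ξ
  rw [mul_assoc, ← Complex.exp_add]
  congr 1
  · dsimp only [waveTransform]
    congr 1 with y
    unfold planeWave
    congr 2
    simp only [Pi.neg_apply, mul_neg, Finset.sum_neg_distrib]
    push_cast
    ring
  · unfold planeWave
    congr 1
    push_cast
    ring

/-- Strichartz inequality for the Schrödinger equation on `ℝ^d`: if `u₀` is Schwartz and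
`u(x,t) = ∫ û₀(ξ) e^{2πi x·ξ} e^{-4π² i |ξ|² t} dξ` solves `∂_t u = iΔu`, then
`‖u‖_{L^{2(d+2)/d}(ℝ^d × ℝ)} ≤ C(d) ‖u₀‖_{L²(ℝ^d)}`. -/
theorem strichartz_schrodinger (d : ℕ) (hd : 1 ≤ d) :
    ∃ C : ℝ, ∀ u₀ : SchwartzMap (Fin d → ℝ) ℂ,
      (∫ z : (Fin d → ℝ) × ℝ,
          ‖∫ ξ : Fin d → ℝ,
              (∫ y : Fin d → ℝ, u₀ y *
                Complex.exp (-(2 * Real.pi * Complex.I) * ((∑ j, y j * ξ j : ℝ) : ℂ))) *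
              Complex.exp (2 * Real.pi * Complex.I * ((∑ j, z.1 j * ξ j : ℝ) : ℂ)) *
              Complex.exp (-(4 * (Real.pi : ℂ) ^ 2 * Complex.I) *
                (((∑ j, ξ j ^ 2) * z.2 : ℝ) : ℂ))‖ ^ ((2 * ((d : ℝ) + 2)) / d))
          ^ ((d : ℝ) / (2 * ((d : ℝ) + 2)))
        ≤ C * (∫ x : Fin d → ℝ, ‖u₀ x‖ ^ 2) ^ ((1 : ℝ) / 2) := by
  have hd0 : (0 : ℝ) < d := by exact_mod_cast hd
  set p : ℝ := 2 * ((d : ℝ) + 2) / d with hp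
  have hp0 : 0 < p := by positivity
  obtain ⟨C, hC⟩ := lintegral_waveExtension_rpow_le hd hp
  refine ⟨C, fun u₀ => ?_⟩
  have hum : Measurable (u₀ : (Fin d → ℝ) → ℂ) := u₀.continuous.measurable
  have hui : Integrable (u₀ : (Fin d → ℝ) → ℂ) := u₀.integrable
  set g : (Fin d → ℝ) → ℂ := fun ξ => waveTransform 0 u₀ (-ξ)
  have hgm : Measurable g := (measurable_waveTransform hum 0).comp measurable_neg
  simp_rw [fourier_integral_eq_waveExtension]
  change (∫ z : (Fin d → ℝ) × ℝ, ‖waveExtension g z.2 z.1‖ ^ p) ^ _ ≤ _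
  have hR0 : 0 ≤ ∫ x, ‖u₀ x‖ ^ 2 := integral_nonneg fun x => by positivity
  by_cases hg : Integrable g
  swap
  · have h0 : ∀ z : (Fin d → ℝ) × ℝ, waveExtension g z.2 z.1 = 0 := by
      intro z
      refine integral_undef fun h => hg ?_
      refine (h.mul_bdd (c := 1) (g := fun ξ => conj (planeWave ξ z.1 z.2))
        (Complex.continuous_conj.measurable.comp (measurable_planeWave measurable_id
          measurable_const measurable_const)).aestronglyMeasurable
        (ae_of_all _ fun ξ => by simp)).congr
        (ae_of_all _ fun ξ => ?_)
      simp only [mul_assoc, Complex.mul_conj', norm_planeWave]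
      simp
    have : (d : ℝ) / (2 * ((d : ℝ) + 2)) ≠ 0 := by positivity
    simp only [h0, norm_zero, Real.zero_rpow hp0.ne', integral_zero, Real.zero_rpow this]
    positivity
  have hgL : ∫⁻ ξ, ‖g ξ‖ₑ ^ (2 : ℝ) ≤ ENNReal.ofReal (∫ x, ‖u₀ x‖ ^ 2) := by
    have h1 : ∫⁻ ξ, ‖g ξ‖ₑ ^ (2 : ℝ) = ∫⁻ ξ, ‖waveTransform 0 u₀ ξ‖ₑ ^ (2 : ℝ) :=
      lintegral_neg_eq_self (fun ξ => ‖waveTransform 0 u₀ ξ‖ₑ ^ (2 : ℝ))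
    have h2 : Integrable fun x => ‖u₀ x‖ ^ 2 := (u₀.memLp 2).integrable_norm_pow (by norm_num)
    rw [h1, ofReal_integral_eq_lintegral_ofReal h2 (ae_of_all _ fun x => by positivity)]
    refine (lintegral_waveTransform_sq_le hum hui 0).trans_eq (lintegral_congr fun x => ?_)
    rw [← ofReal_norm, ENNReal.ofReal_rpow_of_nonneg (norm_nonneg _) (by norm_num), Real.rpow_two]
  have hL : ∫ z : (Fin d → ℝ) × ℝ, ‖waveExtension g z.2 z.1‖ ^ p ≤
      (C * (∫ x, ‖u₀ x‖ ^ 2) ^ ((1 : ℝ) / 2)) ^ p := by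
    have hm : Measurable fun z : (Fin d → ℝ) × ℝ => waveExtension g z.2 z.1 :=
      measurable_waveExtension hgm measurable_snd measurable_fst
    rw [integral_eq_lintegral_of_nonneg_ae (ae_of_all _ fun z => by positivity)
      (hm.norm.pow_const p).aestronglyMeasurable]
    refine ENNReal.toReal_le_of_le_ofReal (by positivity) ?_
    have hswap : ∫⁻ z : (Fin d → ℝ) × ℝ, ‖waveExtension g z.2 z.1‖ₑ ^ p =
        ∫⁻ z : ℝ × (Fin d → ℝ), ‖waveExtension g z.1 z.2‖ₑ ^ p :=
      lintegral_prod_swap (μ := (volume : Measure ℝ)) (ν := (volume : Measure (Fin d → ℝ)))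
        (fun z : ℝ × (Fin d → ℝ) => ‖waveExtension g z.1 z.2‖ₑ ^ p)
    calc _ = ∫⁻ z : (Fin d → ℝ) × ℝ, ‖waveExtension g z.2 z.1‖ₑ ^ p := by
          refine lintegral_congr fun z => ?_
          rw [← ofReal_norm, ENNReal.ofReal_rpow_of_nonneg (norm_nonneg _) hp0.le]
      _ ≤ (C * (∫⁻ ξ, ‖g ξ‖ₑ ^ (2 : ℝ)) ^ (1 / 2 : ℝ)) ^ p := hswap.trans_le (hC g hgm hg)
      _ ≤ (C * ENNReal.ofReal (∫ x, ‖u₀ x‖ ^ 2) ^ (1 / 2 : ℝ)) ^ p := by gcongr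
      _ = _ := by
          rw [ENNReal.ofReal_rpow_of_nonneg hR0 (by norm_num), ← ENNReal.ofReal_coe_nnreal,
            ← ENNReal.ofReal_mul (by positivity),
            ENNReal.ofReal_rpow_of_nonneg (by positivity) hp0.le]
  refine (Real.rpow_le_rpow (integral_nonneg fun z => by positivity) hL (by positivity)).trans_eq ?_
  rw [← Real.rpow_mul (by positivity), show p * ((d : ℝ) / (2 * ((d : ℝ) + 2))) = 1 by
    rw [hp]; field_simp, Real.rpow_one]
end

section
/- (L⁶ estimate for exponential sums on the parabola.) For j = −N, …, N let ω_j = (j/N, j²/N²) ∈ ℝ², and let f(x) = ∑_{j=−N}^{N} a_j e^{2πi ω_j·x} with complex coefficients a_j. Then for every ε > 0 there is a constant C_ε such that for every R ≥ N² and every ball B_R ⊂ ℝ² of radius R, ‖f‖_{L⁶(B_R)} ≤ C_ε N^ε ( ∑_{j=−N}^{N} |a_j|² )^{1/2} |B_R|^{1/6}. -/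
open MeasureTheory

theorem add_one_le_mul_pow_rpow {δ : ℝ} (hδ : 0 < δ) {p : ℕ} (hp : 2 ≤ p) (e : ℕ) :
    (e + 1 : ℝ) ≤ (1 + 1 / (δ * Real.log 2)) * ((p : ℝ) ^ e) ^ δ := by
  have hl : 0 < δ * Real.log 2 := mul_pos hδ (Real.log_pos one_lt_two)
  have h2 : (2 : ℝ) ≤ p := by exact_mod_cast hp
  have h1 : 1 + e * (δ * Real.log 2) ≤ ((p : ℝ) ^ e) ^ δ := by
    calc 1 + e * (δ * Real.log 2) ≤ Real.exp (e * (δ * Real.log 2)) := by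
          rw [add_comm]; exact Real.add_one_le_exp _
      _ = ((2 : ℝ) ^ e) ^ δ := by
          rw [Real.rpow_def_of_pos (by positivity), Real.log_pow]; ring_nf
      _ ≤ _ := by gcongr
  calc (e + 1 : ℝ) ≤ (1 + 1 / (δ * Real.log 2)) * (1 + e * (δ * Real.log 2)) := by
        have : (1 + 1 / (δ * Real.log 2)) * (1 + e * (δ * Real.log 2))
            = e + 1 + (e * (δ * Real.log 2) + 1 / (δ * Real.log 2)) := by
          field_simp; ring
        rw [this]
        have : 0 ≤ e * (δ * Real.log 2) + 1 / (δ * Real.log 2) := by positivity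
        linarith
    _ ≤ _ := by gcongr

theorem add_one_le_pow_rpow {δ : ℝ} (hδ : 0 < δ) {p : ℕ} (hp : (2 : ℝ) ^ (1 / δ) ≤ p) (e : ℕ) :
    (e + 1 : ℝ) ≤ ((p : ℝ) ^ e) ^ δ := by
  have h2 : (2 : ℝ) ≤ (p : ℝ) ^ δ := by
    calc (2 : ℝ) = ((2 : ℝ) ^ (1 / δ)) ^ δ := by
          rw [← Real.rpow_mul zero_le_two, one_div_mul_cancel hδ.ne', Real.rpow_one]
      _ ≤ _ := by gcongr
  calc (e + 1 : ℝ) ≤ 2 ^ e := by exact_mod_cast Nat.lt_two_pow_self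
    _ ≤ ((p : ℝ) ^ δ) ^ e := by gcongr
    _ = _ := by
        rw [← Real.rpow_natCast, ← Real.rpow_mul (by positivity), ← Real.rpow_natCast,
          ← Real.rpow_mul (by positivity), mul_comm]

/-- The divisor bound `d(n) ≪ n ^ δ`. -/
theorem exists_card_divisors_le_rpow {δ : ℝ} (hδ : 0 < δ) :
    ∃ C : ℝ, 0 ≤ C ∧ ∀ n : ℕ, n ≠ 0 → (n.divisors.card : ℝ) ≤ C * (n : ℝ) ^ δ := by
  set M : ℝ := 1 + 1 / (δ * Real.log 2)
  have hM : 1 ≤ M := by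
    have : 0 < δ * Real.log 2 := mul_pos hδ (Real.log_pos one_lt_two)
    simp only [M, le_add_iff_nonneg_right]; positivity
  set P : ℕ := ⌈(2 : ℝ) ^ (1 / δ)⌉₊
  refine ⟨M ^ P, by positivity, fun n hn => ?_⟩
  have key : ∀ p ∈ n.primeFactors, ((n.factorization p + 1 : ℕ) : ℝ) ≤
      (if p < P then M else 1) * ((p : ℝ) ^ n.factorization p) ^ δ := by
    intro p hp
    push_cast
    split_ifs with h
    · exact add_one_le_mul_pow_rpow hδ (Nat.prime_of_mem_primeFactors hp).two_le _
    · rw [one_mul]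
      exact add_one_le_pow_rpow hδ (Nat.ceil_le.1 (not_lt.1 h)) _
  have hprod : ∏ p ∈ n.primeFactors, ((p : ℝ) ^ n.factorization p) ^ δ = (n : ℝ) ^ δ := by
    rw [Real.finsetProd_rpow _ _ (fun _ _ => by positivity)]
    congr 1
    exact_mod_cast Nat.prod_factorization_pow_eq_self hn
  have hsmall : ∏ p ∈ n.primeFactors, (if p < P then M else 1) ≤ M ^ P := by
    rw [← Finset.prod_filter, Finset.prod_const]
    refine pow_le_pow_right₀ hM ?_
    calc _ ≤ (Finset.range P).card := Finset.card_le_card fun p hp => by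
          simpa using (Finset.mem_filter.1 hp).2
      _ = P := Finset.card_range P
  rw [Nat.card_divisors hn, Nat.cast_prod]
  calc _ ≤ ∏ p ∈ n.primeFactors, ((if p < P then M else 1) * ((p : ℝ) ^ n.factorization p) ^ δ) :=
        Finset.prod_le_prod (fun _ _ => by positivity) key
    _ ≤ M ^ P * (n : ℝ) ^ δ := by
        rw [Finset.prod_mul_distrib, hprod]; gcongr

theorem integral_exp_int_mul_period {T : ℝ} (hT : 0 < T) (s : ℝ) (k : ℕ) {m : ℤ} (hm : m ≠ 0) :
    ∫ t in s..(s + k * T), Complex.exp (2 * Real.pi * Complex.I * (m / T * t : ℝ)) = 0 := by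
  have hT' : (T : ℂ) ≠ 0 := by exact_mod_cast hT.ne'
  have hc : (2 * Real.pi * Complex.I * (m / T) : ℂ) ≠ 0 := by
    simp [Real.pi_ne_zero, Complex.I_ne_zero, hm, hT.ne']
  have := integral_exp_mul_complex (a := s) (b := s + k * T) hc
  push_cast at this ⊢
  simp only [← mul_assoc] at this ⊢
  rw [this, div_eq_zero_iff, sub_eq_zero]
  left
  rw [Complex.exp_eq_exp_iff_exists_int]
  refine ⟨m * k, ?_⟩
  push_cast
  field_simp

theorem normSq_sum_exp {ι : Type*} (S : Finset ι) (b : ι → ℂ) (θ : ι → ℝ) :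
    ((‖∑ i ∈ S, b i * Complex.exp (2 * Real.pi * Complex.I * (θ i : ℝ))‖ ^ 2 : ℝ) : ℂ) =
      ∑ i ∈ S, ∑ j ∈ S, b i * (starRingEnd ℂ) (b j) *
        Complex.exp (2 * Real.pi * Complex.I * (θ i - θ j : ℝ)) := by
  rw [Complex.ofReal_pow, ← Complex.mul_conj', map_sum, Finset.sum_mul_sum]
  refine Finset.sum_congr rfl fun i _ => Finset.sum_congr rfl fun j _ => ?_
  rw [map_mul, ← Complex.exp_conj, mul_mul_mul_comm, ← Complex.exp_add]
  congr 2
  simp only [map_mul, map_ofNat, Complex.conj_I, Complex.conj_ofReal, Complex.ofReal_sub]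
  ring

/-- Orthogonality of the characters `e(m t / T)` on an interval made of `k` periods. -/
theorem integral_normSq_sum_exp_period {T : ℝ} (hT : 0 < T) (s : ℝ) (k : ℕ) (S : Finset ℤ)
    (b : ℤ → ℂ) :
    ∫ t in s..(s + k * T),
        ‖∑ m ∈ S, b m * Complex.exp (2 * Real.pi * Complex.I * (m / T * t : ℝ))‖ ^ 2 =
      k * T * ∑ m ∈ S, ‖b m‖ ^ 2 := by
  apply Complex.ofReal_injective
  rw [← intervalIntegral.integral_ofReal]
  simp only [normSq_sum_exp]
  rw [intervalIntegral.integral_finsetSum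
    fun i _ => Continuous.intervalIntegrable (by fun_prop) _ _]
  push_cast
  rw [Finset.mul_sum]
  refine Finset.sum_congr rfl fun i hi => ?_
  rw [intervalIntegral.integral_finsetSum
    fun j _ => Continuous.intervalIntegrable (by fun_prop) _ _, Finset.sum_eq_single i]
  · simp [Complex.mul_conj']
  · intro j _ hji
    have h := integral_exp_int_mul_period hT s k (sub_ne_zero.2 hji.symm)
    push_cast at h
    simp only [← sub_mul, ← sub_div]
    rw [intervalIntegral.integral_const_mul, h, mul_zero]
  · exact fun h => absurd hi h

/-- `L²` bound for a trigonometric polynomial of period `T` on an interval of length `L ≥ T`. -/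
theorem integral_normSq_sum_exp_le {T L : ℝ} (hT : 0 < T) (hTL : T ≤ L) (s : ℝ) (S : Finset ℤ)
    (b : ℤ → ℂ) :
    ∫ t in s..(s + L),
        ‖∑ m ∈ S, b m * Complex.exp (2 * Real.pi * Complex.I * (m / T * t : ℝ))‖ ^ 2 ≤
      2 * L * ∑ m ∈ S, ‖b m‖ ^ 2 := by
  set k := ⌈L / T⌉₊
  have h1 : L ≤ k * T := (div_le_iff₀ hT).1 (Nat.le_ceil _)
  have h2 : k * T ≤ 2 * L := by
    have h3 : (k : ℝ) < L / T + 1 := Nat.ceil_lt_add_one (div_nonneg (hT.le.trans hTL) hT.le)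
    calc k * T ≤ (L / T + 1) * T := by gcongr
      _ = L + T := by field_simp
      _ ≤ 2 * L := by linarith
  calc _ ≤ ∫ t in s..(s + k * T),
        ‖∑ m ∈ S, b m * Complex.exp (2 * Real.pi * Complex.I * (m / T * t : ℝ))‖ ^ 2 := by
        refine intervalIntegral.integral_mono_interval le_rfl (by linarith) (by linarith)
          (Filter.Eventually.of_forall fun t => by positivity)
          (Continuous.intervalIntegrable (by fun_prop) _ _)
    _ ≤ _ := by
        rw [integral_normSq_sum_exp_period hT]
        gcongr

/-- `L²` bound for a two-dimensional trigonometric polynomial with periods `T` and `T'` on a square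
of side `L ≥ max T T'`. -/
theorem integral_integral_normSq_sum_exp_le {T T' L : ℝ} (hT : 0 < T) (hTL : T ≤ L) (hT' : 0 < T')
    (hTL' : T' ≤ L) (s s' : ℝ) (S S' : Finset ℤ) (b : ℤ → ℤ → ℂ) :
    ∫ x in s..(s + L), ∫ y in s'..(s' + L),
        ‖∑ m ∈ S', ∑ n ∈ S, b n m *
          Complex.exp (2 * Real.pi * Complex.I * (n / T * x + m / T' * y : ℝ))‖ ^ 2 ≤
      (2 * L) ^ 2 * ∑ m ∈ S', ∑ n ∈ S, ‖b n m‖ ^ 2 := by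
  have hL : 0 ≤ L := hT.le.trans hTL
  have hinner (x : ℝ) : ∫ y in s'..(s' + L),
        ‖∑ m ∈ S', ∑ n ∈ S, b n m *
          Complex.exp (2 * Real.pi * Complex.I * (n / T * x + m / T' * y : ℝ))‖ ^ 2 ≤
      2 * L * ∑ m ∈ S', ‖∑ n ∈ S, b n m *
          Complex.exp (2 * Real.pi * Complex.I * (n / T * x : ℝ))‖ ^ 2 := by
    convert integral_normSq_sum_exp_le hT' hTL' s' S' (fun m => ∑ n ∈ S, b n m *
          Complex.exp (2 * Real.pi * Complex.I * (n / T * x : ℝ))) using 6 with y m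
    rw [Finset.sum_mul]
    refine Finset.sum_congr rfl fun n _ => ?_
    rw [mul_assoc (b n m), ← Complex.exp_add, Complex.ofReal_add, mul_add]
  calc _ ≤ ∫ x in s..(s + L), 2 * L * ∑ m ∈ S', ‖∑ n ∈ S, b n m *
          Complex.exp (2 * Real.pi * Complex.I * (n / T * x : ℝ))‖ ^ 2 :=
        intervalIntegral.integral_mono (by linarith)
          (Continuous.intervalIntegrable (by fun_prop) _ _)
          (Continuous.intervalIntegrable (by fun_prop) _ _) hinner
    _ = 2 * L * ∑ m ∈ S', ∫ x in s..(s + L), ‖∑ n ∈ S, b n m *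
          Complex.exp (2 * Real.pi * Complex.I * (n / T * x : ℝ))‖ ^ 2 := by
        rw [intervalIntegral.integral_const_mul, intervalIntegral.integral_finsetSum
          fun j _ => Continuous.intervalIntegrable (by fun_prop) _ _]
    _ ≤ 2 * L * ∑ m ∈ S', 2 * L * ∑ n ∈ S, ‖b n m‖ ^ 2 := by
        gcongr with m
        exact integral_normSq_sum_exp_le hT hTL s S (b · m)
    _ = _ := by rw [← Finset.mul_sum]; ring

theorem setIntegral_ball_le_integral_integral {g : ℝ → ℝ → ℝ} (hg : Continuous (Function.uncurry g))
    (hg0 : ∀ x y, 0 ≤ g x y) (c : EuclideanSpace ℝ (Fin 2)) {R : ℝ} (hR : 0 ≤ R) :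
    ∫ x in Metric.ball c R, g (x 0) (x 1) ≤
      ∫ x in (c 0 - R)..(c 0 - R + 2 * R), ∫ y in (c 1 - R)..(c 1 - R + 2 * R), g x y := by
  have he : MeasurePreserving (fun x : EuclideanSpace ℝ (Fin 2) => (x 0, x 1)) :=
    (volume_preserving_finTwoArrow ℝ).comp
      (EuclideanSpace.volume_preserving_symm_measurableEquiv_toLp (Fin 2))
  have hemb : MeasurableEmbedding (fun x : EuclideanSpace ℝ (Fin 2) => (x 0, x 1)) :=
    (((MeasurableEquiv.toLp 2 (Fin 2 → ℝ)).symm).trans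
      (MeasurableEquiv.finTwoArrow (α := ℝ))).measurableEmbedding
  set Q : Set (ℝ × ℝ) := Set.Ioc (c 0 - R) (c 0 - R + 2 * R) ×ˢ Set.Ioc (c 1 - R) (c 1 - R + 2 * R)
  have hball : Metric.ball c R ⊆ (fun x : EuclideanSpace ℝ (Fin 2) => (x 0, x 1)) ⁻¹' Q := by
    intro x hx
    have hcoord (i : Fin 2) : |x i - c i| < R := by
      refine lt_of_le_of_lt ?_ (mem_ball_iff_norm.1 hx)
      simpa using PiLp.norm_apply_le (x - c) i
    have h0 := abs_lt.1 (hcoord 0)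
    have h1 := abs_lt.1 (hcoord 1)
    refine Set.mem_prod.2 ⟨⟨?_, ?_⟩, ⟨?_, ?_⟩⟩ <;> dsimp only <;> linarith
  have hQ : IntegrableOn (Function.uncurry g) Q :=
    (hg.continuousOn.integrableOn_compact (isCompact_Icc.prod isCompact_Icc)).mono_set
      (Set.prod_mono Set.Ioc_subset_Icc_self Set.Ioc_subset_Icc_self)
  calc _ ≤ ∫ x in (fun x : EuclideanSpace ℝ (Fin 2) => (x 0, x 1)) ⁻¹' Q,
          Function.uncurry g (x 0, x 1) := by
        refine setIntegral_mono_set ((he.integrableOn_comp_preimage hemb).2 hQ)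
          (Filter.Eventually.of_forall fun x => hg0 _ _) hball.eventuallyLE
    _ = ∫ z in Q, Function.uncurry g z := he.setIntegral_preimage_emb hemb _ _
    _ = ∫ x in Set.Ioc (c 0 - R) (c 0 - R + 2 * R), ∫ y in Set.Ioc (c 1 - R) (c 1 - R + 2 * R),
          g x y := setIntegral_prod _ hQ
    _ = _ := by
        rw [intervalIntegral.integral_of_le (by linarith)]
        simp_rw [intervalIntegral.integral_of_le (show c 1 - R ≤ c 1 - R + 2 * R by linarith)]

/-- The coefficient of the frequency `(n, m)` in `F² · conj F`. -/
noncomputable def tripleCoeff (I : Finset ℤ) (a : ℤ → ℂ) (n m : ℤ) : ℂ :=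
  ∑ t ∈ I ×ˢ I ×ˢ I with t.1 + t.2.1 - t.2.2 = n ∧ t.1 ^ 2 + t.2.1 ^ 2 - t.2.2 ^ 2 = m,
    a t.1 * a t.2.1 * (starRingEnd ℂ) (a t.2.2)

theorem norm_tripleCoeff_sq_le_card_mul (I : Finset ℤ) (a : ℤ → ℂ) (n m : ℤ) {K : ℝ}
    (hK : (({t ∈ I ×ˢ I ×ˢ I | t.1 + t.2.1 - t.2.2 = n ∧
      t.1 ^ 2 + t.2.1 ^ 2 - t.2.2 ^ 2 = m}.card : ℕ) : ℝ) ≤ K) :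
    ‖tripleCoeff I a n m‖ ^ 2 ≤
      K * ∑ t ∈ I ×ˢ I ×ˢ I with t.1 + t.2.1 - t.2.2 = n ∧ t.1 ^ 2 + t.2.1 ^ 2 - t.2.2 ^ 2 = m,
        ‖a t.1‖ ^ 2 * ‖a t.2.1‖ ^ 2 * ‖a t.2.2‖ ^ 2 := by
  refine (pow_le_pow_left₀ (norm_nonneg _) (norm_sum_le _ _) 2).trans ?_
  refine sq_sum_le_card_mul_sum_sq.trans ?_
  simp only [norm_mul, RCLike.norm_conj, mul_pow]
  gcongr

theorem norm_tripleCoeff_sq_diag (I : Finset ℤ) (a : ℤ → ℂ) (n : ℤ) :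
    ‖tripleCoeff I a n (n ^ 2)‖ ^ 2 ≤
      if n ∈ I then 4 * (∑ j ∈ I, ‖a j‖ ^ 2) ^ 2 * ‖a n‖ ^ 2 else 0 := by
  have hfib : ∀ t ∈ {t ∈ I ×ˢ I ×ˢ I | t.1 + t.2.1 - t.2.2 = n ∧
      t.1 ^ 2 + t.2.1 ^ 2 - t.2.2 ^ 2 = n ^ 2}, n ∈ I ∧
        t ∈ I.image (fun j => (j, n, j)) ∪ I.image (fun j => (n, j, j)) := by
    rintro ⟨i, j, k⟩ ht
    simp only [Finset.mem_filter, Finset.mem_product] at ht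
    obtain ⟨⟨hi, hj, hk⟩, h1, h2⟩ := ht
    have h3 : (i - k) * (j - k) = 0 := by subst h1; linarith
    simp only [Finset.mem_union, Finset.mem_image, Prod.mk.injEq]
    rcases mul_eq_zero.1 h3 with h | h
    · obtain rfl : i = k := by lia
      obtain rfl : j = n := by lia
      exact ⟨hj, Or.inl ⟨i, hi, rfl, rfl, rfl⟩⟩
    · obtain rfl : j = k := by lia
      obtain rfl : i = n := by lia
      exact ⟨hi, Or.inr ⟨j, hj, rfl, rfl, rfl⟩⟩
  split_ifs with hn
  · have : ‖tripleCoeff I a n (n ^ 2)‖ ≤ 2 * (∑ j ∈ I, ‖a j‖ ^ 2) * ‖a n‖ := by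
      have hin : Function.Injective (fun j : ℤ => (j, n, j)) := fun i j h => by simpa using h
      have hin' : Function.Injective (fun j : ℤ => (n, j, j)) := fun i j h => by simpa using h
      calc _ ≤ ∑ t ∈ I.image (fun j => (j, n, j)) ∪ I.image (fun j => (n, j, j)),
              ‖a t.1 * a t.2.1 * (starRingEnd ℂ) (a t.2.2)‖ :=
            (norm_sum_le _ _).trans (Finset.sum_le_sum_of_subset_of_nonneg
              (fun t ht => (hfib t ht).2) fun _ _ _ => norm_nonneg _)
        _ ≤ ∑ t ∈ I.image (fun j => (j, n, j)), ‖a t.1 * a t.2.1 * (starRingEnd ℂ) (a t.2.2)‖ +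
            ∑ t ∈ I.image (fun j => (n, j, j)), ‖a t.1 * a t.2.1 * (starRingEnd ℂ) (a t.2.2)‖ := by
            rw [← Finset.sum_union_inter]
            exact le_add_of_nonneg_right (by positivity)
        _ = _ := by
            rw [Finset.sum_image hin.injOn, Finset.sum_image hin'.injOn, ← Finset.sum_add_distrib,
              Finset.mul_sum, Finset.sum_mul]
            refine Finset.sum_congr rfl fun j _ => ?_
            simp only [norm_mul, RCLike.norm_conj]
            ring
    calc _ ≤ (2 * (∑ j ∈ I, ‖a j‖ ^ 2) * ‖a n‖) ^ 2 := by gcongr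
      _ = _ := by ring
  · rw [tripleCoeff, Finset.sum_eq_zero fun t ht => absurd (hfib t ht).1 hn]
    simp

theorem card_intDivisors_le (E : ℤ) (hE : E ≠ 0) (U : Finset ℤ) (hU : ∀ u ∈ U, u ∣ E) :
    U.card ≤ 2 * E.natAbs.divisors.card := by
  calc U.card ≤ (E.natAbs.divisors.image (fun d : ℕ => (d : ℤ)) ∪
          E.natAbs.divisors.image (fun d : ℕ => -(d : ℤ))).card := by
        refine Finset.card_le_card fun u hu => ?_
        have hd : u.natAbs ∈ E.natAbs.divisors :=
          Nat.mem_divisors.2 ⟨Int.natAbs_dvd_natAbs.2 (hU u hu), Int.natAbs_ne_zero.2 hE⟩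
        simp only [Finset.mem_union, Finset.mem_image]
        rcases Int.natAbs_eq u with h | h
        · exact Or.inl ⟨_, hd, h.symm⟩
        · exact Or.inr ⟨_, hd, h.symm⟩
    _ ≤ _ := (Finset.card_union_le _ _).trans (by
        rw [two_mul]; exact add_le_add Finset.card_image_le Finset.card_image_le)

theorem card_triples_le {δ C : ℝ} (hδ : 0 < δ)
    (hC : ∀ n : ℕ, n ≠ 0 → (n.divisors.card : ℝ) ≤ C * (n : ℝ) ^ δ) (hC0 : 0 ≤ C) (N : ℕ)
    {n m : ℤ} (hnm : m ≠ n ^ 2) :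
    (({t ∈ Finset.Icc (-(N : ℤ)) N ×ˢ Finset.Icc (-(N : ℤ)) N ×ˢ Finset.Icc (-(N : ℤ)) N |
      t.1 + t.2.1 - t.2.2 = n ∧ t.1 ^ 2 + t.2.1 ^ 2 - t.2.2 ^ 2 = m}.card : ℕ) : ℝ) ≤
      2 * (C * (8 * (N : ℝ) ^ 2) ^ δ) := by
  set F := {t ∈ Finset.Icc (-(N : ℤ)) N ×ˢ Finset.Icc (-(N : ℤ)) N ×ˢ Finset.Icc (-(N : ℤ)) N |
      t.1 + t.2.1 - t.2.2 = n ∧ t.1 ^ 2 + t.2.1 ^ 2 - t.2.2 ^ 2 = m} with hF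
  have hE : n ^ 2 - m ≠ 0 := fun h => hnm (by linarith)
  have hfac : ∀ t ∈ F, 2 * ((t.1 - t.2.2) * (t.2.1 - t.2.2)) = n ^ 2 - m := by
    intro t ht
    obtain ⟨-, h1, h2⟩ := Finset.mem_filter.1 ht
    rw [← h1, ← h2]; ring
  rcases F.eq_empty_or_nonempty with h0 | ⟨t, ht⟩
  · rw [h0]; simp; positivity
  have hsize : (n ^ 2 - m).natAbs ≤ 8 * N ^ 2 := by
    rw [← hfac t ht]
    have hmem := (Finset.mem_filter.1 ht).1
    simp only [Finset.mem_product, Finset.mem_Icc] at hmem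
    have hu : (t.1 - t.2.2).natAbs ≤ 2 * N := by lia
    have hv : (t.2.1 - t.2.2).natAbs ≤ 2 * N := by lia
    rw [Int.natAbs_mul, Int.natAbs_mul]
    calc _ ≤ 2 * ((2 * N) * (2 * N)) := Nat.mul_le_mul le_rfl (Nat.mul_le_mul hu hv)
      _ = _ := by ring
  have hinj : Set.InjOn (fun t : ℤ × ℤ × ℤ => t.1 - t.2.2) F := by
    rintro ⟨i, j, k⟩ ht ⟨i', j', k'⟩ ht' h
    have e := hfac _ ht
    have e' := hfac _ ht'
    have s := (Finset.mem_filter.1 ht).2.1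
    have s' := (Finset.mem_filter.1 ht').2.1
    simp only at h e e' s s'
    have hne : i - k ≠ 0 := fun h0 => hE (by rw [← e, h0]; ring)
    have : (i - k) * (j - k) = (i - k) * (j' - k') := by rw [← h] at e'; linarith
    have := mul_left_cancel₀ hne this
    simp only [Prod.mk.injEq]
    lia
  have hcard : F.card ≤ 2 * (n ^ 2 - m).natAbs.divisors.card := by
    rw [← Finset.card_image_of_injOn hinj]
    refine card_intDivisors_le _ hE _ fun u hu => ?_
    obtain ⟨t, ht, rfl⟩ := Finset.mem_image.1 hu
    exact ⟨2 * (t.2.1 - t.2.2), by rw [← hfac t ht]; ring⟩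
  calc (F.card : ℝ) ≤ 2 * ((n ^ 2 - m).natAbs.divisors.card : ℝ) := by exact_mod_cast hcard
    _ ≤ 2 * (C * ((n ^ 2 - m).natAbs : ℝ) ^ δ) := by
        gcongr; exact hC _ (Int.natAbs_ne_zero.2 hE)
    _ ≤ _ := by
        gcongr; exact_mod_cast hsize

/-- The `ℓ²` bound for the Fourier coefficients of `F² · conj F`. -/
theorem sum_norm_tripleCoeff_sq_le (I S S' : Finset ℤ) (a : ℤ → ℂ) {K : ℝ} (hK0 : 0 ≤ K)
    (hK : ∀ n m : ℤ, m ≠ n ^ 2 → (({t ∈ I ×ˢ I ×ˢ I | t.1 + t.2.1 - t.2.2 = n ∧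
      t.1 ^ 2 + t.2.1 ^ 2 - t.2.2 ^ 2 = m}.card : ℕ) : ℝ) ≤ K) :
    ∑ m ∈ S', ∑ n ∈ S, ‖tripleCoeff I a n m‖ ^ 2 ≤ (K + 4) * (∑ j ∈ I, ‖a j‖ ^ 2) ^ 3 := by
  set A := ∑ j ∈ I, ‖a j‖ ^ 2
  set w : ℤ × ℤ × ℤ → ℝ := fun t => ‖a t.1‖ ^ 2 * ‖a t.2.1‖ ^ 2 * ‖a t.2.2‖ ^ 2
  set d : ℤ → ℝ := fun n => if n ∈ I then 4 * A ^ 2 * ‖a n‖ ^ 2 else 0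
  have hd0 : ∀ n, 0 ≤ d n := fun n => by simp only [d]; split_ifs <;> positivity
  have hpt : ∀ n m, ‖tripleCoeff I a n m‖ ^ 2 ≤
      K * (∑ t ∈ I ×ˢ I ×ˢ I with t.1 + t.2.1 - t.2.2 = n ∧ t.1 ^ 2 + t.2.1 ^ 2 - t.2.2 ^ 2 = m, w t)
        + if m = n ^ 2 then d n else 0 := by
    intro n m
    by_cases h : m = n ^ 2
    · subst h
      rw [if_pos rfl]
      exact (norm_tripleCoeff_sq_diag I a n).trans (le_add_of_nonneg_left (by positivity))
    · rw [if_neg h, add_zero]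
      exact norm_tripleCoeff_sq_le_card_mul I a n m (hK n m h)
  have hdiag : ∑ m ∈ S', ∑ n ∈ S, (if m = n ^ 2 then d n else 0) ≤ 4 * A ^ 3 := by
    rw [Finset.sum_comm]
    calc _ ≤ ∑ n ∈ S, d n := by
          refine Finset.sum_le_sum fun n _ => ?_
          rw [Finset.sum_ite_eq']
          split_ifs
          exacts [le_rfl, hd0 n]
      _ = ∑ n ∈ S with n ∈ I, 4 * A ^ 2 * ‖a n‖ ^ 2 := by rw [Finset.sum_filter]
      _ ≤ ∑ n ∈ I, 4 * A ^ 2 * ‖a n‖ ^ 2 :=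
          Finset.sum_le_sum_of_subset_of_nonneg (fun n hn => (Finset.mem_filter.1 hn).2)
            fun _ _ _ => by positivity
      _ = 4 * A ^ 3 := by rw [← Finset.mul_sum]; ring
  have hfib : ∑ m ∈ S', ∑ n ∈ S,
      (∑ t ∈ I ×ˢ I ×ˢ I with t.1 + t.2.1 - t.2.2 = n ∧ t.1 ^ 2 + t.2.1 ^ 2 - t.2.2 ^ 2 = m, w t)
        ≤ A ^ 3 := by
    simp only [Finset.sum_filter]
    calc _ = ∑ t ∈ I ×ˢ I ×ˢ I, ∑ m ∈ S', ∑ n ∈ S,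
          (if t.1 + t.2.1 - t.2.2 = n ∧ t.1 ^ 2 + t.2.1 ^ 2 - t.2.2 ^ 2 = m then w t else 0) := by
          rw [Finset.sum_comm (s := I ×ˢ I ×ˢ I)]
          exact Finset.sum_congr rfl fun m _ => Finset.sum_comm
      _ ≤ ∑ t ∈ I ×ˢ I ×ˢ I, w t := by
          refine Finset.sum_le_sum fun t _ => ?_
          have hw : 0 ≤ w t := by positivity
          simp only [ite_and, Finset.sum_ite_eq]
          split_ifs <;> simp [hw]
          split_ifs <;> simp [hw]
      _ = A ^ 3 := by
          simp only [Finset.sum_product, w, A, ← Finset.mul_sum, ← Finset.sum_mul]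
          ring
  calc _ ≤ _ := Finset.sum_le_sum fun m _ => Finset.sum_le_sum fun n _ => hpt n m
    _ ≤ K * A ^ 3 + 4 * A ^ 3 := by
        simp only [Finset.sum_add_distrib, ← Finset.mul_sum]
        gcongr
    _ = _ := by ring

/-- `F² · conj F` grouped by frequency, for `F = ∑ a j e(j u + j² v)`. -/
theorem norm_sum_exp_pow_six (I : Finset ℤ) (a : ℤ → ℂ) {T T' : ℝ} (x y : ℝ) :
    ‖∑ j ∈ I, a j * Complex.exp (2 * Real.pi * Complex.I *
        ((j : ℝ) / T * x + (j : ℝ) ^ 2 / T' * y : ℝ))‖ ^ 6 =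
      ‖∑ m ∈ (I ×ˢ I ×ˢ I).image (fun t => t.1 ^ 2 + t.2.1 ^ 2 - t.2.2 ^ 2),
        ∑ n ∈ (I ×ˢ I ×ˢ I).image (fun t => t.1 + t.2.1 - t.2.2), tripleCoeff I a n m *
          Complex.exp (2 * Real.pi * Complex.I * (n / T * x + m / T' * y : ℝ))‖ ^ 2 := by
  set F := ∑ j ∈ I, a j * Complex.exp (2 * Real.pi * Complex.I *
        ((j : ℝ) / T * x + (j : ℝ) ^ 2 / T' * y : ℝ)) with hF
  have hnorm : ‖F‖ ^ 6 = ‖F * (F * (starRingEnd ℂ) F)‖ ^ 2 := by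
    rw [norm_mul, norm_mul, RCLike.norm_conj]; ring
  rw [hnorm]
  congr 2
  have hexp : F * (F * (starRingEnd ℂ) F) = ∑ t ∈ I ×ˢ I ×ˢ I,
      a t.1 * a t.2.1 * (starRingEnd ℂ) (a t.2.2) * Complex.exp (2 * Real.pi * Complex.I *
        ((t.1 + t.2.1 - t.2.2 : ℤ) / T * x + (t.1 ^ 2 + t.2.1 ^ 2 - t.2.2 ^ 2 : ℤ) / T' * y : ℝ)) := by
    rw [hF, map_sum, Finset.sum_mul_sum, ← Finset.sum_product', Finset.sum_mul_sum,
      ← Finset.sum_product']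
    refine Finset.sum_congr rfl fun t _ => ?_
    have harg : (2 * Real.pi * Complex.I * ((t.1 + t.2.1 - t.2.2 : ℤ) / T * x +
          (t.1 ^ 2 + t.2.1 ^ 2 - t.2.2 ^ 2 : ℤ) / T' * y : ℝ) : ℂ) =
        2 * Real.pi * Complex.I * ((t.1 : ℝ) / T * x + (t.1 : ℝ) ^ 2 / T' * y : ℝ) +
        (2 * Real.pi * Complex.I * ((t.2.1 : ℝ) / T * x + (t.2.1 : ℝ) ^ 2 / T' * y : ℝ) +
        (starRingEnd ℂ) (2 * Real.pi * Complex.I *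
          ((t.2.2 : ℝ) / T * x + (t.2.2 : ℝ) ^ 2 / T' * y : ℝ))) := by
      simp only [map_mul, map_ofNat, Complex.conj_I, Complex.conj_ofReal]
      push_cast
      ring
    rw [harg, Complex.exp_add, Complex.exp_add, Complex.exp_conj, map_mul]
    ring
  rw [hexp]
  simp only [tripleCoeff, Finset.sum_mul]
  rw [← Finset.sum_fiberwise_of_maps_to (fun t ht => Finset.mem_image_of_mem
    (fun t : ℤ × ℤ × ℤ => t.1 ^ 2 + t.2.1 ^ 2 - t.2.2 ^ 2) ht)]
  refine Finset.sum_congr rfl fun m _ => ?_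
  rw [← Finset.sum_fiberwise_of_maps_to (fun t ht => Finset.mem_image_of_mem
    (fun t : ℤ × ℤ × ℤ => t.1 + t.2.1 - t.2.2) (Finset.mem_of_mem_filter t ht))]
  refine Finset.sum_congr rfl fun n _ => ?_
  rw [Finset.filter_filter]
  simp only [and_comm (a := _ = m)]
  refine Finset.sum_congr rfl fun t ht => ?_
  obtain ⟨-, rfl, rfl⟩ := Finset.mem_filter.1 ht
  rfl

theorem setIntegral_ball_norm_sum_exp_pow_six_le {δ C : ℝ} (hδ : 0 < δ) (hC0 : 0 ≤ C)
    (hC : ∀ n : ℕ, n ≠ 0 → (n.divisors.card : ℝ) ≤ C * (n : ℝ) ^ δ) {N : ℕ} (hN : 1 ≤ N)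
    (a : ℤ → ℂ) {R : ℝ} (hR : (N : ℝ) ^ 2 ≤ R) (c : EuclideanSpace ℝ (Fin 2)) :
    ∫ x in Metric.ball c R, ‖∑ j ∈ Finset.Icc (-(N : ℤ)) N, a j *
        Complex.exp (2 * Real.pi * Complex.I *
          (((j : ℝ) / N * x 0 + (j : ℝ) ^ 2 / (N : ℝ) ^ 2 * x 1 : ℝ) : ℂ))‖ ^ 6 ≤
      (4 * R) ^ 2 * ((2 * (C * (8 * (N : ℝ) ^ 2) ^ δ) + 4) *
        (∑ j ∈ Finset.Icc (-(N : ℤ)) N, ‖a j‖ ^ 2) ^ 3) := by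
  have hN1 : (1 : ℝ) ≤ N := by exact_mod_cast hN
  have hNR : (N : ℝ) ≤ R := (le_self_pow₀ hN1 two_ne_zero).trans hR
  have hR0 : 0 ≤ R := by linarith
  refine (setIntegral_ball_le_integral_integral (g := fun x y =>
    ‖∑ j ∈ Finset.Icc (-(N : ℤ)) N, a j * Complex.exp (2 * Real.pi * Complex.I *
      (((j : ℝ) / N * x + (j : ℝ) ^ 2 / (N : ℝ) ^ 2 * y : ℝ) : ℂ))‖ ^ 6)
    (by unfold Function.uncurry; fun_prop) (fun x y => by positivity) c hR0).trans ?_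
  simp only [norm_sum_exp_pow_six]
  refine (integral_integral_normSq_sum_exp_le (by positivity) (by linarith) (by positivity)
    (by linarith) _ _ _ _ _).trans ?_
  rw [← mul_assoc 2 2 R, show (2 : ℝ) * 2 = 4 by norm_num]
  gcongr
  exact sum_norm_tripleCoeff_sq_le _ _ _ a (by positivity) fun n m h => card_triples_le hδ hC hC0 N h

/-- L⁶ estimate for exponential sums on the parabola: for frequencies
`ω_j = (j/N, j²/N²)` and `f(x) = ∑_{j=-N}^N a_j e^{2πi ω_j·x}`, on any ball of radius `R ≥ N²`,
`‖f‖_{L⁶(B_R)} ≤ C_ε N^ε (∑ |a_j|²)^{1/2} |B_R|^{1/6}`. -/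
theorem exp_sum_parabola_L6 (ε : ℝ) (hε : 0 < ε) :
    ∃ C : ℝ, ∀ N : ℕ, 1 ≤ N → ∀ a : ℤ → ℂ, ∀ R : ℝ, (N : ℝ) ^ 2 ≤ R →
      ∀ c : EuclideanSpace ℝ (Fin 2),
      (∫ x in Metric.ball c R,
          ‖∑ j ∈ Finset.Icc (-(N : ℤ)) N,
              a j * Complex.exp (2 * Real.pi * Complex.I *
                (((j : ℝ) / N * x 0 + (j : ℝ) ^ 2 / (N : ℝ) ^ 2 * x 1 : ℝ) : ℂ))‖ ^ 6)
          ^ ((1 : ℝ) / 6)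
        ≤ C * (N : ℝ) ^ ε * (∑ j ∈ Finset.Icc (-(N : ℤ)) N, ‖a j‖ ^ 2) ^ ((1 : ℝ) / 2) *
            (volume (Metric.ball c R)).toReal ^ ((1 : ℝ) / 6) := by
  obtain ⟨C, hC0, hC⟩ := exists_card_divisors_le_rpow (show 0 < 3 * ε by positivity)
  set D : ℝ := 16 * (2 * C * 8 ^ (3 * ε) + 4)
  refine ⟨D ^ ((1 : ℝ) / 6), fun N hN a R hR c => ?_⟩
  have hN1 : (1 : ℝ) ≤ N := by exact_mod_cast hN
  have hR0 : 0 ≤ R := le_trans (by positivity) hR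
  set A := ∑ j ∈ Finset.Icc (-(N : ℤ)) N, ‖a j‖ ^ 2
  have hA : 0 ≤ A := by positivity
  have hD : 0 ≤ D := by positivity
  have hvol : R ^ 2 ≤ (volume (Metric.ball c R)).toReal := by
    rw [EuclideanSpace.volume_ball_fin_two]
    simp only [ENNReal.toReal_mul, ENNReal.toReal_pow, ENNReal.toReal_ofReal hR0]
    refine le_mul_of_one_le_right (by positivity) ?_
    simpa [ENNReal.toReal_ofReal Real.pi_nonneg] using one_le_two.trans Real.two_le_pi
  set V := (volume (Metric.ball c R)).toReal
  have hpow : (N : ℝ) ^ (6 * ε) = ((N : ℝ) ^ ε) ^ 6 := by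
    rw [← Real.rpow_natCast, ← Real.rpow_mul (by positivity), mul_comm]; norm_num
  have hpow8 : (8 * (N : ℝ) ^ 2) ^ (3 * ε) = 8 ^ (3 * ε) * ((N : ℝ) ^ ε) ^ 6 := by
    rw [Real.mul_rpow (by positivity) (by positivity), ← hpow, ← Real.rpow_natCast,
      ← Real.rpow_mul (by positivity)]
    congr 2
    push_cast
    ring
  have hNε : 1 ≤ ((N : ℝ) ^ ε) ^ 6 := one_le_pow₀ (Real.one_le_rpow hN1 hε.le)
  have hmain := setIntegral_ball_norm_sum_exp_pow_six_le (by positivity) hC0 hC hN a hR c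
  rw [hpow8] at hmain
  have hroot : (A ^ ((1 : ℝ) / 2)) ^ 6 = A ^ 3 := by
    rw [← Real.rpow_natCast, ← Real.rpow_mul hA, ← Real.rpow_natCast]; norm_num
  rw [one_div 6, Real.rpow_inv_le_iff_of_pos (by positivity) (by positivity) (by norm_num)]
  refine hmain.trans ?_
  have hsix (x : ℝ) : x ^ (6 : ℝ) = x ^ 6 := by exact_mod_cast Real.rpow_natCast x 6
  have hinv {x : ℝ} (hx : 0 ≤ x) : (x ^ (6 : ℝ)⁻¹) ^ 6 = x := by
    rw [← hsix, Real.rpow_inv_rpow hx (by norm_num)]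
  rw [hsix, mul_pow, mul_pow, mul_pow, mul_pow, hinv hD, hinv ENNReal.toReal_nonneg, hroot]
  calc _ ≤ 16 * R ^ 2 * ((2 * (C * (8 ^ (3 * ε) * ((N : ℝ) ^ ε) ^ 6)) +
          4 * ((N : ℝ) ^ ε) ^ 6) * A ^ 3) := by
        rw [show (4 : ℝ) ^ 2 = 16 by norm_num]
        gcongr
        linarith
    _ = D * ((N : ℝ) ^ ε) ^ 6 * A ^ 3 * R ^ 2 := by simp only [D]; ring
    _ ≤ _ := by gcongr
end

section
/- (Sharpness example for the parabola level-set bound.) Let N ≥ 1 be an integer and define f : ℝ² → ℂ by f(x₁, x₂) = ∑_{n=1}^{N} e^{2πi( (n/N) x₁ + (n²/N²) x₂ )}. Then for every integer m and every x = (x₁, x₂) with |x₁ − mN| ≤ 1/100 and |x₂| ≤ 1/100, each term of the sum has real part greater than 1/2, and consequently |f(x)| ≥ N/2. -/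
theorem half_lt_re_exp_two_pi_mul_I_of_near_int {t : ℝ} (k : ℤ) (ht : |t - k| ≤ 1 / 50) :
    (1 : ℝ) / 2 < (Complex.exp (2 * Real.pi * Complex.I * (t : ℂ))).re := by
  have harg : 2 * (Real.pi : ℂ) * Complex.I * (t : ℂ)
      = ((2 * Real.pi * t : ℝ) : ℂ) * Complex.I := by
    push_cast
    ring
  have hcos : Real.cos (2 * Real.pi * t) = Real.cos (2 * Real.pi * (t - k)) := by
    rw [← Real.cos_sub_int_mul_two_pi (2 * Real.pi * t) k]
    congr 1
    ring
  have hsmall : |2 * Real.pi * (t - k)| ≤ 1 / 2 := by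
    rw [abs_mul, abs_of_pos Real.two_pi_pos]
    nlinarith [Real.pi_le_four, Real.pi_pos, abs_nonneg (t - k)]
  rw [harg, Complex.exp_ofReal_mul_I_re, hcos]
  have hsq := sq_le_sq' (abs_le.mp hsmall).1 (abs_le.mp hsmall).2
  linarith [Real.one_sub_sq_div_two_le_cos (x := 2 * Real.pi * (t - k))]

theorem abs_parabola_phase_sub_int_le {N n : ℕ} (hN : 1 ≤ N) (hn : n ≤ N) (m : ℤ) {x₁ x₂ δ : ℝ}
    (h₁ : |x₁ - (m : ℝ) * N| ≤ δ) (h₂ : |x₂| ≤ δ) :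
    |(n : ℝ) / N * x₁ + (n : ℝ) ^ 2 / (N : ℝ) ^ 2 * x₂ - ((n * m : ℤ) : ℝ)| ≤ 2 * δ := by
  have hN0 : (N : ℝ) ≠ 0 := by positivity
  have hr0 : 0 ≤ (n : ℝ) / N := by positivity
  have hr1 : (n : ℝ) / N ≤ 1 := div_le_one_of_le₀ (by exact_mod_cast hn) (by positivity)
  have hphase : (n : ℝ) / N * x₁ + (n : ℝ) ^ 2 / (N : ℝ) ^ 2 * x₂ - ((n * m : ℤ) : ℝ)
      = (n : ℝ) / N * (x₁ - m * N) + ((n : ℝ) / N) ^ 2 * x₂ := by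
    push_cast
    field_simp
    ring
  rw [hphase]
  refine (abs_add_le _ _).trans ?_
  rw [abs_mul, abs_mul, abs_of_nonneg hr0, abs_of_nonneg (pow_nonneg hr0 2)]
  have hlin := mul_le_of_le_one_left (abs_nonneg (x₁ - m * N)) hr1
  have hquad := mul_le_of_le_one_left (abs_nonneg x₂) (pow_le_one₀ hr0 hr1 (n := 2))
  linarith

/-- Sharpness example for the parabola level-set bound: for
`f(x₁,x₂) = ∑_{n=1}^N e^{2πi((n/N)x₁ + (n²/N²)x₂)}`, at every point with `|x₁ - mN| ≤ 1/100`
(`m ∈ ℤ`) and `|x₂| ≤ 1/100`, every term of the sum has real part greater than `1/2`, and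
consequently `|f(x)| ≥ N/2`. -/
theorem parabola_exp_sum_large_near_peaks (N : ℕ) (hN : 1 ≤ N) (m : ℤ) (x₁ x₂ : ℝ)
    (h₁ : |x₁ - (m : ℝ) * N| ≤ 1 / 100) (h₂ : |x₂| ≤ 1 / 100) :
    (∀ n ∈ Finset.Icc 1 N,
        (1 : ℝ) / 2 < (Complex.exp (2 * Real.pi * Complex.I *
          (((n : ℝ) / N * x₁ + (n : ℝ) ^ 2 / (N : ℝ) ^ 2 * x₂ : ℝ) : ℂ))).re) ∧
      (N : ℝ) / 2 ≤
        ‖∑ n ∈ Finset.Icc 1 N, Complex.exp (2 * Real.pi * Complex.I *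
          (((n : ℝ) / N * x₁ + (n : ℝ) ^ 2 / (N : ℝ) ^ 2 * x₂ : ℝ) : ℂ))‖ := by
  have hre : ∀ n ∈ Finset.Icc 1 N,
      (1 : ℝ) / 2 < (Complex.exp (2 * Real.pi * Complex.I *
        (((n : ℝ) / N * x₁ + (n : ℝ) ^ 2 / (N : ℝ) ^ 2 * x₂ : ℝ) : ℂ))).re := fun n hn =>
    half_lt_re_exp_two_pi_mul_I_of_near_int (n * m)
      ((abs_parabola_phase_sub_int_le hN (Finset.mem_Icc.mp hn).2 m h₁ h₂).trans (by norm_num))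
  refine ⟨hre, le_trans ?_ (Complex.re_le_norm _)⟩
  rw [Complex.re_sum]
  calc (N : ℝ) / 2 = ∑ _n ∈ Finset.Icc 1 N, (1 : ℝ) / 2 := by
        simp [div_eq_mul_inv]
    _ ≤ _ := Finset.sum_le_sum fun n hn => (hre n hn).le
end
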